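/- arXiv:1111.1592 — 3 statements merged into one kernel-verified Lean document; each statement's English description precedes it below -/
import Mathlib

section
/- (Adjoining a row.) Let n > m ≥ 0 and let B be an n×n non-negative integer matrix whose last n−m rows are zero, such that A = J_{nm} + B is irreducible and the top-left m×m corner of A is irreducible. Let x₁, x₂, …, xₙ be non-negative integers, not all zero, and let j be an index with m < j ≤ n. Let A' be the (n+1)×(n+1) matrix over ℕ ∪ {∞} whose first row is (x_j, x₁, x₂, …, xₙ), whose first column is (x_j, A(1,j), A(2,j), …, A(m,j), ∞, …, ∞)ᵀ, whose remaining top-right n×n block in rows 2,…,m+1 agrees with rows 1,…,m of A, and whose rows m+2,…,n+1 have every entry equal to ∞. Then A ∼_M A'. -/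
/-- A directed graph as used in the theory of graph `C*`-algebras:
a type of vertices, a type of edges, and range and source maps. -/
structure CKGraph : Type 1 where
  V : Type
  E : Type
  r : E → V
  s : E → V

namespace CKGraph

/-- An isomorphism of graphs: bijections of vertices and edges intertwining
the range and source maps. -/
structure Iso (G H : CKGraph) where
  vEquiv : G.V ≃ H.V
  eEquiv : G.E ≃ H.E
  map_r : ∀ e, H.r (eEquiv e) = vEquiv (G.r e)
  map_s : ∀ e, H.s (eEquiv e) = vEquiv (G.s e)

/-- A vertex is a source if it receives no edges. -/
def IsSource (G : CKGraph) (v : G.V) : Prop := ∀ e, G.r e ≠ v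

/-- A vertex is a sink if it emits no edges. -/
def IsSink (G : CKGraph) (v : G.V) : Prop := ∀ e, G.s e ≠ v

/-- A vertex is an infinite emitter if it emits infinitely many edges. -/
def IsInfiniteEmitter (G : CKGraph) (v : G.V) : Prop := {e | G.s e = v}.Infinite

/-- A vertex is regular if it is neither a sink nor an infinite emitter. -/
def Regular (G : CKGraph) (v : G.V) : Prop :=
  (∃ e, G.s e = v) ∧ {e | G.s e = v}.Finite

/-- There is a (nonempty) path from `u` to `v` in `G`. -/
inductive HasPath (G : CKGraph) : G.V → G.V → Prop
  | single (e : G.E) : HasPath G (G.s e) (G.r e)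
  | cons (e : G.E) {v : G.V} : HasPath G (G.r e) v → HasPath G (G.s e) v

/-- `G.Geq u v` is the relation `u ≥ v`: `u = v` or there is a path from `u` to `v`. -/
def Geq (G : CKGraph) (u v : G.V) : Prop := u = v ∨ G.HasPath u v

/-- There is a (nonempty) path from `u` to `v` all of whose vertices lie in `S`. -/
inductive HasPathIn (G : CKGraph) (S : Set G.V) : G.V → G.V → Prop
  | single (e : G.E) : G.s e ∈ S → G.r e ∈ S → HasPathIn G S (G.s e) (G.r e)
  | cons (e : G.E) {v : G.V} : G.s e ∈ S → HasPathIn G S (G.r e) v →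
      HasPathIn G S (G.s e) v

/-- The nonempty list of edges `l` is a path from `u` to `v`. -/
def IsPathFromTo (G : CKGraph) (l : List G.E) (u v : G.V) : Prop :=
  ∃ h : l ≠ [], l.Chain' (fun e f => G.r e = G.s f) ∧
    G.s (l.head h) = u ∧ G.r (l.getLast h) = v

/-- The list of edges `l` is a simple loop based at `v`: a loop at `v` such that the
range of every non-final edge is different from `v`. -/
def IsSimpleLoopAt (G : CKGraph) (v : G.V) (l : List G.E) : Prop :=
  G.IsPathFromTo l v v ∧ ∀ e ∈ l.dropLast, G.r e ≠ v

/-- A set of vertices is hereditary if it contains the range of every edge whose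
source it contains. -/
def Hereditary (G : CKGraph) (H : Set G.V) : Prop := ∀ e, G.s e ∈ H → G.r e ∈ H

/-- A set of vertices is saturated if it contains every regular vertex all of whose
emitted edges have range in the set. -/
def Saturated (G : CKGraph) (H : Set G.V) : Prop :=
  ∀ v, G.Regular v → (∀ e, G.s e = v → G.r e ∈ H) → v ∈ H

/-- Move (S): removing the (regular) source `v` together with all edges it emits. -/
def removeSource (G : CKGraph) (v : G.V) (hsrc : G.IsSource v) : CKGraph where
  V := {w : G.V // w ≠ v}
  E := {e : G.E // G.s e ≠ v}
  r e := ⟨G.r e.1, hsrc e.1⟩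
  s e := ⟨G.s e.1, e.2⟩

/-- Move (R): the reduction at a vertex `u` that emits exactly one edge `f` with
`r f ≠ u` and receives only from the single vertex `v`. -/
def reduce (G : CKGraph) (u : G.V) (f : G.E) (hf : G.s f = u) (hrf : G.r f ≠ u)
    (honly : ∀ e, G.s e = u → e = f) (v : G.V) (hin : ∀ e, G.r e = u → G.s e = v) :
    CKGraph where
  V := {w : G.V // w ≠ u}
  E := {e : G.E // G.r e ≠ u ∧ e ≠ f} ⊕ {e : G.E // G.r e = u}
  r x :=
    match x with
    | .inl e => ⟨G.r e.1, e.2.1⟩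
    | .inr _ => ⟨G.r f, hrf⟩
  s x :=
    match x with
    | .inl e => ⟨G.s e.1, fun h => e.2.2 (honly e.1 h)⟩
    | .inr e => ⟨G.s e.1, by
        intro h
        have h2 : G.r e.1 = u := e.2
        rw [honly e.1 h] at h2
        exact hrf h2⟩

/-- Move (O): the out-split of `G` at `v` according to the partition of `s⁻¹(v)`
into the fibres of `P`. -/
noncomputable def outSplit (G : CKGraph) (v : G.V) (n : ℕ)
    (P : {e : G.E // G.s e = v} → Fin n) : CKGraph :=
  letI := Classical.decEq G.V
  { V := {w : G.V // w ≠ v} ⊕ Fin n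
    E := {e : G.E // G.r e ≠ v} ⊕ ({e : G.E // G.r e = v} × Fin n)
    r := fun x =>
      match x with
      | .inl e => Sum.inl ⟨G.r e.1, e.2⟩
      | .inr p => Sum.inr p.2
    s := fun x =>
      match x with
      | .inl e =>
          if h : G.s e.1 = v then Sum.inr (P ⟨e.1, h⟩) else Sum.inl ⟨G.s e.1, h⟩
      | .inr p =>
          if h : G.s p.1.1 = v then Sum.inr (P ⟨p.1.1, h⟩)
          else Sum.inl ⟨G.s p.1.1, h⟩ }

/-- Move (I): the in-split of `G` at `v` according to the partition of `r⁻¹(v)`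
into the fibres of `P`. -/
noncomputable def inSplit (G : CKGraph) (v : G.V) (n : ℕ)
    (P : {e : G.E // G.r e = v} → Fin n) : CKGraph :=
  letI := Classical.decEq G.V
  { V := {w : G.V // w ≠ v} ⊕ Fin n
    E := {e : G.E // G.s e ≠ v} ⊕ ({e : G.E // G.s e = v} × Fin n)
    s := fun x =>
      match x with
      | .inl e => Sum.inl ⟨G.s e.1, e.2⟩
      | .inr p => Sum.inr p.2
    r := fun x =>
      match x with
      | .inl e =>
          if h : G.r e.1 = v then Sum.inr (P ⟨e.1, h⟩) else Sum.inl ⟨G.r e.1, h⟩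
      | .inr p =>
          if h : G.r p.1.1 = v then Sum.inr (P ⟨p.1.1, h⟩)
          else Sum.inl ⟨G.r p.1.1, h⟩ }

/-- Move-equivalence: the smallest equivalence relation on graphs with finitely many
vertices such that `G ∼ H` whenever `H` is obtained from `G`, up to graph
isomorphism, by one of the moves (S), (I), (O), (R). -/
inductive MoveEquiv : CKGraph → CKGraph → Prop
  | of_iso {G H : CKGraph} (hG : Finite G.V) (h : Nonempty (Iso G H)) : MoveEquiv G H
  | moveS {G : CKGraph} (hG : Finite G.V) (v : G.V) (hreg : G.Regular v)
      (hsrc : G.IsSource v) {H : CKGraph}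
      (h : Nonempty (Iso H (G.removeSource v hsrc))) : MoveEquiv G H
  | moveR {G : CKGraph} (hG : Finite G.V) (u : G.V) (f : G.E) (hf : G.s f = u)
      (hrf : G.r f ≠ u) (honly : ∀ e, G.s e = u → e = f) (v : G.V)
      (hin : ∀ e, G.r e = u → G.s e = v) {H : CKGraph}
      (h : Nonempty (Iso H (G.reduce u f hf hrf honly v hin))) : MoveEquiv G H
  | moveO {G : CKGraph} (hG : Finite G.V) (v : G.V) (hns : ¬ G.IsSink v) (n : ℕ)
      (P : {e : G.E // G.s e = v} → Fin n) (hsurj : Function.Surjective P)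
      (hinf : ∀ i j : Fin n, {x : {e : G.E // G.s e = v} | P x = i}.Infinite →
        {x : {e : G.E // G.s e = v} | P x = j}.Infinite → i = j)
      {H : CKGraph} (h : Nonempty (Iso H (G.outSplit v n P))) : MoveEquiv G H
  | moveI {G : CKGraph} (hG : Finite G.V) (v : G.V) (hreg : G.Regular v)
      (hns : ¬ G.IsSource v) (n : ℕ) (P : {e : G.E // G.r e = v} → Fin n)
      (hsurj : Function.Surjective P) {H : CKGraph}
      (h : Nonempty (Iso H (G.inSplit v n P))) : MoveEquiv G H
  | symm {G H : CKGraph} : MoveEquiv G H → MoveEquiv H G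
  | trans {G H K : CKGraph} : MoveEquiv G H → MoveEquiv H K → MoveEquiv G K

/-- The graph obtained from `G` by collapsing a regular non-source vertex `v` that
emits exactly one edge `f₀`, which is not a loop: delete `v`, `f₀` and all edges into
`v`, and add an edge `[e f₀]` from `s e` to `r f₀` for every edge `e` into `v`. -/
def collapseOne (G : CKGraph) (v : G.V) (f₀ : G.E) (hf : G.s f₀ = v)
    (honly : ∀ e, G.s e = v → e = f₀) (hr : G.r f₀ ≠ v) : CKGraph where
  V := {w : G.V // w ≠ v}
  E := {e : G.E // G.r e ≠ v ∧ e ≠ f₀} ⊕ {e : G.E // G.r e = v}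
  r x :=
    match x with
    | .inl e => ⟨G.r e.1, e.2.1⟩
    | .inr _ => ⟨G.r f₀, hr⟩
  s x :=
    match x with
    | .inl e => ⟨G.s e.1, fun h => e.2.2 (honly e.1 h)⟩
    | .inr e => ⟨G.s e.1, by
        intro h
        have h2 : G.r e.1 = v := e.2
        rw [honly e.1 h] at h2
        exact hr h2⟩

/-- The graph obtained from `G` by collapsing a regular vertex `v` which does not
support a loop of length one: delete `v` and all edges into or out of `v`, and add
an edge `[e f]` from `s e` to `r f` for every pair of edges `e, f` with
`r e = v = s f`. -/
def collapse (G : CKGraph) (v : G.V) (hnl : ∀ e, G.s e = v → G.r e ≠ v) :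
    CKGraph where
  V := {w : G.V // w ≠ v}
  E := {e : G.E // G.r e ≠ v ∧ G.s e ≠ v} ⊕
    ({e : G.E // G.r e = v} × {f : G.E // G.s f = v})
  s x :=
    match x with
    | .inl e => ⟨G.s e.1, e.2.2⟩
    | .inr p => ⟨G.s p.1.1, fun h => hnl p.1.1 h p.1.2⟩
  r x :=
    match x with
    | .inl e => ⟨G.r e.1, e.2.1⟩
    | .inr p => ⟨G.r p.2.1, fun h => hnl p.2.1 p.2.2 h⟩

/-- The graph obtained from `G` by adding countably infinitely many new edges,
each with source `u` and range `w`. -/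
def addEdges (G : CKGraph) (u w : G.V) : CKGraph where
  V := G.V
  E := G.E ⊕ ℕ
  r x := match x with | .inl e => G.r e | .inr _ => w
  s x := match x with | .inl e => G.s e | .inr _ => u

/-- The graph with exactly one vertex and no edges. -/
def singletonGraph : CKGraph where
  V := PUnit
  E := Empty
  r e := e.elim
  s e := e.elim

/-- The Cuntz splice of `G` at `v`: add two new vertices `u₁, u₂` and six new edges:
`v → u₁`, `u₁ → v`, a loop at `u₁`, `u₁ → u₂`, `u₂ → u₁`, and a loop at `u₂`. -/
def cuntzSplice (G : CKGraph) (v : G.V) : CKGraph where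
  V := G.V ⊕ Fin 2
  E := G.E ⊕ Fin 6
  s x :=
    match x with
    | .inl e => Sum.inl (G.s e)
    | .inr i => ![Sum.inl v, Sum.inr 0, Sum.inr 0, Sum.inr 0, Sum.inr 1, Sum.inr 1] i
  r x :=
    match x with
    | .inl e => Sum.inl (G.r e)
    | .inr i => ![Sum.inr 0, Sum.inl v, Sum.inr 0, Sum.inr 1, Sum.inr 0, Sum.inr 1] i

/-- The adjacency matrix (as an integer matrix) of a graph whose vertices are
enumerated by `Fin n`. -/
noncomputable def adjMatrix (G : CKGraph) {n : ℕ} (ρ : G.V ≃ Fin n) :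
    Matrix (Fin n) (Fin n) ℤ :=
  Matrix.of fun i j => (Nat.card {e : G.E // G.s e = ρ.symm i ∧ G.r e = ρ.symm j} : ℤ)

end CKGraph

/-- The graph of an `ℕ∞`-valued square matrix: it has exactly `A x y` edges from
`x` to `y`. -/
def graphOfMatrix {n : ℕ} (A : Matrix (Fin n) (Fin n) ℕ∞) : CKGraph where
  V := Fin n
  E := Σ x : Fin n, Σ y : Fin n, {k : ℕ // (k : ℕ∞) < A x y}
  s e := e.1
  r e := e.2.1

/-- Move-equivalence of (possibly differently sized) square matrices over `ℕ∞`. -/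
def MatMoveEquiv {m n : ℕ} (A : Matrix (Fin m) (Fin m) ℕ∞)
    (B : Matrix (Fin n) (Fin n) ℕ∞) : Prop :=
  CKGraph.MoveEquiv (graphOfMatrix A) (graphOfMatrix B)

/-- A square matrix is irreducible if any index connects to any other index through
a chain of non-zero entries. -/
def MatIrreducible {n : ℕ} {α : Type*} [Zero α] (A : Matrix (Fin n) (Fin n) α) :
    Prop :=
  ∀ i j : Fin n, ∃ (l : ℕ) (c : ℕ → Fin n), 1 ≤ l ∧ c 0 = i ∧ c l = j ∧
    ∀ t < l, A (c t) (c (t + 1)) ≠ 0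

/-- `Jmat n m` is the `n × n` matrix whose top-left `m × m` block is the identity,
whose other entries in the first `m` rows are `0`, and whose last `n - m` rows have
every entry equal to `∞`. -/
def Jmat (n m : ℕ) : Matrix (Fin n) (Fin n) ℕ∞ :=
  Matrix.of fun i j => if i.1 < m then (if i = j then 1 else 0) else ⊤

namespace CKGraph

/-- A bijection of vertices preserving the number of edges between any two vertices
extends to an isomorphism of graphs. -/
theorem nonempty_iso_of_fibers {G H : CKGraph} (φ : G.V ≃ H.V)
    (h : ∀ u v, Nonempty ({e : G.E // (G.s e, G.r e) = (u, v)} ≃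
      {e : H.E // (H.s e, H.r e) = (φ u, φ v)})) : Nonempty (Iso G H) := by
  let ψ := fun p : G.V × G.V => (h p.1 p.2).some
  let ε : G.E ≃ H.E := (Equiv.sigmaFiberEquiv fun e => (G.s e, G.r e)).symm.trans
    ((Equiv.sigmaCongr (Equiv.prodCongr φ φ) ψ).trans
      (Equiv.sigmaFiberEquiv fun e => (H.s e, H.r e)))
  have key (e : G.E) : (H.s (ε e), H.r (ε e)) = (φ (G.s e), φ (G.r e)) :=
    (ψ (G.s e, G.r e) ⟨e, rfl⟩).2
  exact ⟨⟨φ, ε, fun e => congrArg Prod.snd (key e), fun e => congrArg Prod.fst (key e)⟩⟩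

section OutSplit

variable (G : CKGraph) (v : G.V) (n : ℕ) (P : {e : G.E // G.s e = v} → Fin n)

/-- The vertex of `G` underlying a vertex of the out-split. -/
def outSplitProj : {w : G.V // w ≠ v} ⊕ Fin n → G.V :=
  Sum.elim Subtype.val fun _ => v

/-- The edges of `G` which are emitted by a given vertex of the out-split. -/
def OutSplitEmits (e : G.E) : {w : G.V // w ≠ v} ⊕ Fin n → Prop :=
  Sum.elim (fun w => G.s e = w.1) fun i => ∃ h : G.s e = v, P ⟨e, h⟩ = i

/-- The edges between two vertices of the out-split correspond to the edges of `G` with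
the underlying range which are emitted by the first vertex. -/
theorem nonempty_outSplit_fiber_equiv (a b : {w : G.V // w ≠ v} ⊕ Fin n) :
    Nonempty ({e : (G.outSplit v n P).E //
        ((G.outSplit v n P).s e, (G.outSplit v n P).r e) = (a, b)} ≃
      {e : G.E // G.OutSplitEmits v n P e a ∧ G.r e = G.outSplitProj v n b}) := by
  let lower : (G.outSplit v n P).E → G.E := Sum.elim Subtype.val fun p => p.1.1
  have hs (e) : G.OutSplitEmits v n P (lower e) ((G.outSplit v n P).s e) := by
    rcases e with e | p
    · by_cases h : G.s e.1 = v <;> simp [lower, outSplit, OutSplitEmits, h]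
    · by_cases h : G.s p.1.1 = v <;> simp [lower, outSplit, OutSplitEmits, h]
  have hr (e) : G.r (lower e) = G.outSplitProj v n ((G.outSplit v n P).r e) := by
    rcases e with e | p
    · rfl
    · exact p.1.2
  have hu (e : G.E) (a b : {w : G.V // w ≠ v} ⊕ Fin n) (ha : G.OutSplitEmits v n P e a)
      (hb : G.OutSplitEmits v n P e b) : a = b := by
    rcases a with a | a <;> rcases b with b | b <;> simp only [OutSplitEmits, Sum.elim_inl,
      Sum.elim_inr] at ha hb
    · exact congrArg Sum.inl (Subtype.ext (ha.symm.trans hb))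
    · exact absurd (ha.symm.trans hb.1) a.2
    · exact absurd (hb.symm.trans ha.1) b.2
    · exact congrArg Sum.inr (ha.2.symm.trans hb.2)
  refine ⟨Equiv.ofBijective (fun e => ⟨lower e.1, ?_, ?_⟩) ⟨?_, ?_⟩⟩
  · exact (congrArg (G.OutSplitEmits v n P _) (congrArg Prod.fst e.2)).mp (hs e.1)
  · exact (hr e.1).trans (congrArg (G.outSplitProj v n) (congrArg Prod.snd e.2))
  · rintro ⟨e, he⟩ ⟨f, hf⟩ hef
    have h1 : lower e = lower f := congrArg Subtype.val hef
    have h2 : (G.outSplit v n P).r e = (G.outSplit v n P).r f :=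
      (congrArg Prod.snd he).trans (congrArg Prod.snd hf).symm
    refine Subtype.ext ?_
    rcases e with e | p <;> rcases f with f | q
    · exact congrArg Sum.inl (Subtype.ext h1)
    · exact absurd h2 Sum.inl_ne_inr
    · exact absurd h2 Sum.inr_ne_inl
    · exact congrArg Sum.inr (Prod.ext (Subtype.ext h1) (Sum.inr.inj h2))
  · rintro ⟨e, hea, heb⟩
    rcases b with b | i
    · have h : G.r e ≠ v := fun h => b.2 (heb.symm.trans h)
      refine ⟨⟨Sum.inl ⟨e, h⟩, Prod.ext (hu e _ _ (hs (Sum.inl ⟨e, h⟩)) hea) ?_⟩, rfl⟩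
      exact congrArg Sum.inl (Subtype.ext heb)
    · exact ⟨⟨Sum.inr (⟨e, heb⟩, i),
        Prod.ext (hu e _ _ (hs (Sum.inr (⟨e, heb⟩, i))) hea) rfl⟩, rfl⟩

end OutSplit

end CKGraph

/-- The edges between two vertices of the graph of a matrix which satisfy a given
condition correspond to the labels satisfying it. -/
def graphOfMatrixFiberEquiv {n : ℕ} (A : Matrix (Fin n) (Fin n) ℕ∞)
    (Q : (graphOfMatrix A).E → Prop) (p : ℕ → Prop) (u w : Fin n)
    (h : ∀ k hk, Q ⟨u, w, k, hk⟩ ↔ (graphOfMatrix A).s ⟨u, w, k, hk⟩ = u ∧ p k)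
    (hu : ∀ e, Q e → (graphOfMatrix A).s e = u) :
    {e : (graphOfMatrix A).E // Q e ∧ (graphOfMatrix A).r e = w} ≃
      {k : ℕ // (k : ℕ∞) < A u w ∧ p k} where
  toFun e := ⟨e.1.2.2.1, by
    obtain ⟨⟨u', w', k, hk⟩, he, hw⟩ := e
    obtain rfl : u' = u := hu _ he
    obtain rfl : w' = w := hw
    exact ⟨hk, ((h k hk).1 he).2⟩⟩
  invFun k := ⟨⟨u, w, k.1, k.2.1⟩, (h _ _).2 ⟨rfl, k.2.2⟩, rfl⟩
  left_inv := by
    rintro ⟨⟨u', w', k, hk⟩, he, hw⟩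
    obtain rfl : u' = u := hu _ he
    obtain rfl : w' = w := hw
    rfl
  right_inv _ := rfl

/-- Out-splitting off finitely many edges from a vertex which emits infinitely many edges
to every vertex. -/
theorem matMoveEquiv_of_outSplit {n : ℕ} (A : Matrix (Fin n) (Fin n) ℕ∞)
    (A' : Matrix (Fin (n + 1)) (Fin (n + 1)) ℕ∞) (x : Fin n → ℕ) (hx : ∃ i, x i ≠ 0)
    (j : Fin n) (hj : ∀ i, A j i = ⊤)
    (h0 : ∀ l, A' 0 l = x (Fin.cases j id l : Fin n))
    (hsucc : ∀ i l, A' (Fin.succ i) l = A i (Fin.cases j id l : Fin n)) :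
    MatMoveEquiv A A' := by
  classical
  have lt_top (i : Fin n) (k : ℕ) : (k : ℕ∞) < A j i := by
    rw [hj]
    exact ENat.natCast_lt_top k
  let P : {e : (graphOfMatrix A).E // (graphOfMatrix A).s e = j} → Fin 2 :=
    fun e => if e.1.2.2.1 < x e.1.2.1 then 0 else 1
  let φ : Fin (n + 1) → {w : Fin n // w ≠ j} ⊕ Fin 2 :=
    Fin.cases (Sum.inr 0) fun i => if h : i = j then Sum.inr 1 else Sum.inl ⟨i, h⟩
  have hφ0 : φ 0 = Sum.inr 0 := rfl
  have hφs (i : Fin n) : φ i.succ = if h : i = j then Sum.inr 1 else Sum.inl ⟨i, h⟩ := rfl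
  have hφj : φ j.succ = Sum.inr 1 := by simp [hφs]
  have hφne (i : Fin n) (h : i ≠ j) : φ i.succ = Sum.inl ⟨i, h⟩ := by simp [hφs, h]
  have hπ (l : Fin (n + 1)) :
      (graphOfMatrix A).outSplitProj j 2 (φ l) = (Fin.cases j id l : Fin n) := by
    refine Fin.cases rfl (fun i => ?_) l
    by_cases h : i = j
    · subst h
      rw [hφj]
      rfl
    · rw [hφne i h]
      rfl
  have hφ : Function.Bijective φ := by
    constructor
    · intro a b
      refine Fin.cases ?_ (fun a => ?_) a <;> refine Fin.cases ?_ (fun b => ?_) b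
      · simp
      · by_cases h : b = j <;> simp [hφ0, hφs, h]
      · by_cases h : a = j <;> simp [hφ0, hφs, h]
      · by_cases h : a = j <;> by_cases h' : b = j <;> simp [hφs, h, h']
    · rintro (⟨i, h⟩ | i)
      · exact ⟨i.succ, hφne i h⟩
      · fin_cases i
        · exact ⟨0, rfl⟩
        · exact ⟨j.succ, hφj⟩
  refine CKGraph.MoveEquiv.moveO (G := graphOfMatrix A) (inferInstanceAs (Finite (Fin n))) j
    (fun h => h ⟨j, j, 0, lt_top j 0⟩ rfl) 2 P ?_ ?_
    (CKGraph.nonempty_iso_of_fibers (G := graphOfMatrix A')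
      (H := (graphOfMatrix A).outSplit j 2 P) (Equiv.ofBijective φ hφ) fun (u l : Fin (n + 1)) => ?_)
  · intro i
    fin_cases i
    · obtain ⟨i, hi⟩ := hx
      exact ⟨⟨⟨j, i, 0, lt_top i 0⟩, rfl⟩, if_pos (Nat.pos_of_ne_zero hi)⟩
    · exact ⟨⟨⟨j, j, x j, lt_top j _⟩, rfl⟩, if_neg (lt_irrefl _)⟩
  · have hfin : {e | P e = 0}.Finite := by
      refine Set.Finite.subset (Set.finite_range fun q : Σ i : Fin n, Fin (x i) =>
        (⟨⟨j, q.1, q.2.1, lt_top q.1 q.2.1⟩, rfl⟩ :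
          {e : (graphOfMatrix A).E // (graphOfMatrix A).s e = j})) ?_
      rintro ⟨⟨u, i, k, hk⟩, hu⟩ he
      obtain rfl : u = j := hu
      have hki : k < x i := by
        by_contra hc
        exact one_ne_zero ((if_neg hc).symm.trans he : (1 : Fin 2) = 0)
      exact ⟨⟨i, k, hki⟩, rfl⟩
    intro a b ha hb
    have hne (c : Fin 2) (hc : {e | P e = c}.Infinite) : c = 1 := by
      fin_cases c
      · exact absurd hfin hc
      · rfl
    rw [hne a ha, hne b hb]
  · let w : Fin n := Fin.cases j id l
    obtain ⟨ε⟩ := (graphOfMatrix A).nonempty_outSplit_fiber_equiv j 2 P (φ u) (φ l)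
    suffices h : Nonempty ({k : ℕ // (k : ℕ∞) < A' u l ∧ True} ≃
        {e : (graphOfMatrix A).E //
          (graphOfMatrix A).OutSplitEmits j 2 P e (φ u) ∧ (graphOfMatrix A).r e = w}) by
      obtain ⟨δ⟩ := h
      refine ⟨((Equiv.subtypeEquivRight fun e => ?_).trans
        (graphOfMatrixFiberEquiv A' (fun e => (graphOfMatrix A').s e = u) (fun _ => True) u l
          (by simp) fun _ => id)).trans (δ.trans
          ((Equiv.subtypeEquivRight fun e => ?_).trans ε.symm))⟩
      · exact Prod.ext_iff
      · exact Iff.of_eq (congrArg (_ ∧ _ = ·) (hπ l).symm)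
    refine Fin.cases ?_ (fun i => ?_) u
    · refine ⟨(Equiv.subtypeEquivRight fun k => ?_).trans
        (graphOfMatrixFiberEquiv A _ (fun k => k < x w) j w (fun k hk => ?_) ?_).symm⟩
      · simp [h0, lt_top, w]
      · simp [hφ0, CKGraph.OutSplitEmits, P, graphOfMatrix]
      · exact fun e he => he.1
    · by_cases hi : i = j
      · subst hi
        have : Infinite {k : ℕ // (k : ℕ∞) < A' i.succ l ∧ True} := by
          simp only [hsucc, lt_top, and_true]
          exact (Equiv.subtypeUnivEquiv fun _ => trivial).infinite_iff.2 inferInstance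
        have : Infinite {k : ℕ // (k : ℕ∞) < A i w ∧ ¬ k < x w} := by
          simp only [lt_top, true_and, not_lt]
          exact (Set.Ici_infinite (x w)).to_subtype
        obtain ⟨η⟩ := nonempty_equiv_of_countable
          (α := {k : ℕ // (k : ℕ∞) < A' i.succ l ∧ True})
          (β := {k : ℕ // (k : ℕ∞) < A i w ∧ ¬ k < x w})
        refine ⟨η.trans
          (graphOfMatrixFiberEquiv A _ (fun k => ¬ k < x w) i w (fun k hk => ?_) ?_).symm⟩
        · simp [hφj, CKGraph.OutSplitEmits, P, graphOfMatrix]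
        · rw [hφj]
          exact fun e he => he.1
      · refine ⟨(Equiv.subtypeEquivRight fun k => ?_).trans
          (graphOfMatrixFiberEquiv A _ (fun _ => True) i w (fun k hk => ?_) ?_).symm⟩
        · rw [hsucc]
        · simp [hφne i hi, CKGraph.OutSplitEmits, graphOfMatrix]
        · rw [hφne i hi]
          exact fun e he => he

/-- Adjoining a row. -/
theorem stmt11 {n m : ℕ} (hmn : m < n) (B : Matrix (Fin n) (Fin n) ℕ)
    (hzero : ∀ i : Fin n, m ≤ i.1 → ∀ j, B i j = 0)
    (hirr : MatIrreducible (Jmat n m + B.map ((↑) : ℕ → ℕ∞)))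
    (hcorner : MatIrreducible ((Jmat n m + B.map ((↑) : ℕ → ℕ∞)).submatrix
      (Fin.castLE hmn.le) (Fin.castLE hmn.le)))
    (x : Fin n → ℕ) (hx : ∃ i, x i ≠ 0) (j : Fin n) (hj : m ≤ j.1) :
    MatMoveEquiv (Jmat n m + B.map ((↑) : ℕ → ℕ∞))
      (Matrix.of fun k l : Fin (n + 1) =>
        if k.1 = 0 then
          (if l.1 = 0 then (x j : ℕ∞)
           else (x ⟨l.1 - 1, by have h1 := l.2; omega⟩ : ℕ∞))
        else if hk : k.1 - 1 < m then
          (if l.1 = 0 then (Jmat n m + B.map ((↑) : ℕ → ℕ∞)) ⟨k.1 - 1, by omega⟩ j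
           else (Jmat n m + B.map ((↑) : ℕ → ℕ∞)) ⟨k.1 - 1, by omega⟩
             ⟨l.1 - 1, by have h1 := l.2; omega⟩)
        else ⊤) := by
  refine matMoveEquiv_of_outSplit _ _ x hx j (fun i => ?_) (fun l => ?_) fun i l => ?_
  · simp [Jmat, hj.not_gt]
  · refine Fin.cases ?_ (fun l => ?_) l <;> simp
  · by_cases hi : i.1 < m
    · refine Fin.cases ?_ (fun l => ?_) l <;> simp [hi]
    · simp [Jmat, hi]
end

section
/- Let n > m ≥ 0 and let B be an n×n non-negative integer matrix whose last n−m rows are zero, such that A = J_{nm} + B is irreducible and the top-left m×m corner of A is irreducible. For every k ∈ ℕ with k ≥ n+2 there is a k×k matrix C satisfying: (i) every entry in the first k−(n−m) rows of C is a non-zero (finite) non-negative integer; (ii) at least one entry of C equals 1; (iii) every entry in the last n−m rows of C is zero; and (iv) J_{nm} + B ∼_M J_{k,k−(n−m)} + C. -/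
namespace CKGraph

open Cardinal

/-- Two graphs are isomorphic if, along a bijection of the vertices, there are equally many
edges between any two vertices. -/
theorem nonempty_iso_of_card {G H : CKGraph} (φ : G.V ≃ H.V)
    (h : ∀ x y, #{e // G.s e = x ∧ G.r e = y} = #{e // H.s e = φ x ∧ H.r e = φ y}) :
    Nonempty (Iso G H) := by
  have h' : ∀ p : G.V × G.V, Nonempty ({e // (G.s e, G.r e) = p} ≃
      {e // (φ.symm (H.s e), φ.symm (H.r e)) = p}) := by
    rintro ⟨x, y⟩
    obtain ⟨f⟩ := Cardinal.eq.1 (h x y)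
    exact ⟨(Equiv.subtypeEquivRight (by simp)).trans
      (f.trans (Equiv.subtypeEquivRight (by simp [Equiv.symm_apply_eq])))⟩
  let F : ∀ p : G.V × G.V, _ := fun p => (h' p).some
  let ψ : G.E ≃ H.E := (Equiv.sigmaFiberEquiv fun e => (G.s e, G.r e)).symm.trans
    ((Equiv.sigmaCongrRight F).trans
      (Equiv.sigmaFiberEquiv fun e => (φ.symm (H.s e), φ.symm (H.r e))))
  have key : ∀ e, (φ.symm (H.s (ψ e)), φ.symm (H.r (ψ e))) = (G.s e, G.r e) := fun e =>
    (F (G.s e, G.r e) ⟨e, rfl⟩).2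
  refine ⟨⟨φ, ψ, fun e => ?_, fun e => ?_⟩⟩
  · rw [← φ.symm_apply_eq]
    exact congrArg Prod.snd (key e)
  · rw [← φ.symm_apply_eq]
    exact congrArg Prod.fst (key e)

/-- Inversion of isomorphisms. -/
def Iso.inv {G H : CKGraph} (i : Iso G H) : Iso H G where
  vEquiv := i.vEquiv.symm
  eEquiv := i.eEquiv.symm
  map_r e := by rw [Equiv.eq_symm_apply, ← i.map_r, Equiv.apply_symm_apply]
  map_s e := by rw [Equiv.eq_symm_apply, ← i.map_s, Equiv.apply_symm_apply]

/-- The graph obtained by reversing all edges. -/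
abbrev op (G : CKGraph) : CKGraph := ⟨G.V, G.E, G.s, G.r⟩

/-- The graph on `V` with `A x y` edges from `x` to `y`. -/
abbrev ofAdj {V : Type} (A : V → V → ℕ∞) : CKGraph where
  V := V
  E := Σ x : V, Σ y : V, {k : ℕ // (k : ℕ∞) < A x y}
  s e := e.1
  r e := e.2.1

theorem mk_lt_enat (a : ℕ∞) : #{k : ℕ // (k : ℕ∞) < a} = a := by
  induction a using ENat.recTopCoe with
  | top => exact (Cardinal.mk_congr (Equiv.subtypeUnivEquiv ENat.natCast_lt_top)).trans (by simp)
  | coe n =>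
    rw [Cardinal.mk_congr (Equiv.subtypeEquivRight
      (fun k => (Nat.cast_lt : (k : ℕ∞) < n ↔ _)) : _ ≃ {k : ℕ // k < n})]
    rw [Cardinal.mk_congr (Fin.equivSubtype (n := n)).symm]
    simp

theorem finite_lt_enat {a : ℕ∞} (ha : a ≠ ⊤) : Finite {k : ℕ // (k : ℕ∞) < a} := by
  rw [← Cardinal.lt_aleph0_iff_finite, mk_lt_enat]
  simpa [lt_top_iff_ne_top] using ha

theorem mk_lt_add (a : ℕ∞) {b : ℕ∞} (hb : b ≠ ⊤) :
    #{k : ℕ // (k : ℕ∞) < a + b ∧ ¬ (k : ℕ∞) < b} = a := by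
  lift b to ℕ using hb
  rw [← mk_lt_enat a]
  symm
  refine Cardinal.mk_congr (Equiv.ofBijective (fun k => ⟨k.1 + b, ?_, ?_⟩) ⟨?_, ?_⟩)
  · push_cast
    exact (ENat.add_lt_add_iff_right (ENat.natCast_ne_top b)).2 k.2
  · simp
  · intro k l h
    simpa [Subtype.ext_iff] using h
  · rintro ⟨k, h1, h2⟩
    have h3 : b ≤ k := by simpa using h2
    obtain ⟨l, rfl⟩ := Nat.exists_eq_add_of_le' h3
    refine ⟨⟨l, ?_⟩, rfl⟩
    push_cast at h1
    exact (ENat.add_lt_add_iff_right (ENat.natCast_ne_top b)).1 h1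

theorem mk_lt_add' (a b : ℕ∞) :
    #{k : ℕ // (k : ℕ∞) < a + b ∧ (k : ℕ∞) < b} = b := by
  rw [← mk_lt_enat b]
  exact Cardinal.mk_congr (Equiv.subtypeEquivRight fun k =>
    ⟨fun h => h.2, fun h => ⟨h.trans_le le_add_self, h⟩⟩)

section ofAdj

variable {V W : Type}

/-- The edges of `ofAdj A` from `x` to `y` satisfying a predicate on labels. -/
theorem mk_edges_ofAdj (A : V → V → ℕ∞) (x y : V) (p : (ofAdj A).E → Prop) :
    #{e : (ofAdj A).E // (ofAdj A).s e = x ∧ (ofAdj A).r e = y ∧ p e} =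
      #{k : ℕ // ∃ h : (k : ℕ∞) < A x y, p ⟨x, y, k, h⟩} := by
  symm
  refine Cardinal.mk_congr (Equiv.ofBijective
    (fun k => ⟨⟨x, y, k.1, k.2.1⟩, rfl, rfl, k.2.2⟩) ⟨?_, ?_⟩)
  · rintro ⟨k, hk⟩ ⟨l, hl⟩ h
    have h' := congrArg (fun e => e.1.2.2.1) h
    exact Subtype.ext h'
  · rintro ⟨⟨x', y', k, hk⟩, h1, h2, h3⟩
    obtain rfl : x' = x := h1
    obtain rfl : y' = y := h2
    exact ⟨⟨k, hk, h3⟩, rfl⟩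

theorem mk_fiber_ofAdj (A : V → V → ℕ∞) (x y : V) :
    #{e : (ofAdj A).E // (ofAdj A).s e = x ∧ (ofAdj A).r e = y} = A x y := by
  have := mk_edges_ofAdj A x y fun _ => True
  simpa [mk_lt_enat] using this

theorem nonempty_iso_ofAdj {G : CKGraph} (φ : G.V ≃ V) (A : V → V → ℕ∞)
    (h : ∀ x y, #{e // G.s e = x ∧ G.r e = y} = A (φ x) (φ y)) :
    Nonempty (Iso G (ofAdj A)) :=
  nonempty_iso_of_card (H := ofAdj A) φ fun x y => (h x y).trans (mk_fiber_ofAdj A _ _).symm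

theorem moveEquiv_ofAdj_reindex [Finite V] (φ : V ≃ W) {A : V → V → ℕ∞} {A' : W → W → ℕ∞}
    (h : ∀ x y, A x y = A' (φ x) (φ y)) : MoveEquiv (ofAdj A) (ofAdj A') :=
  .of_iso ‹_› (nonempty_iso_ofAdj (G := ofAdj A) φ A' fun x y =>
    (mk_fiber_ofAdj A x y).trans (congrArg _ (h x y)))

theorem moveEquiv_of_eq [Finite V] {A A' : V → V → ℕ∞} (h : ∀ x y, A x y = A' x y) :
    MoveEquiv (ofAdj A) (ofAdj A') :=
  moveEquiv_ofAdj_reindex (Equiv.refl V) h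

theorem finite_ofAdj_edges [Finite V] {A : V → V → ℕ∞} (v : V) (b : V → ℕ∞)
    (hb : ∀ y, b y ≠ ⊤) :
    {e : (ofAdj A).E | e.1 = v ∧ (e.2.2.1 : ℕ∞) < b e.2.1}.Finite := by
  have := fun y => finite_lt_enat (hb y)
  refine Set.Finite.subset (Set.finite_range
    (fun t : {t : Σ y : V, {k : ℕ // (k : ℕ∞) < b y} // (t.2.1 : ℕ∞) < A v t.1} =>
      (⟨v, t.1.1, t.1.2.1, t.2⟩ : (ofAdj A).E))) ?_
  rintro ⟨x, y, k, hk⟩ ⟨h1, h2⟩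
  obtain rfl : x = v := h1
  exact ⟨⟨⟨y, k, h2⟩, hk⟩, rfl⟩

theorem regular_ofAdj [Finite V] {A : V → V → ℕ∞} {v : V} (h0 : ∃ y, A v y ≠ 0)
    (hfin : ∀ y, A v y ≠ ⊤) : (ofAdj A).Regular v := by
  obtain ⟨y, hy⟩ := h0
  refine ⟨⟨⟨v, y, 0, by simpa [pos_iff_ne_zero] using hy⟩, rfl⟩, ?_⟩
  refine (finite_ofAdj_edges v (A v) hfin).subset ?_
  rintro ⟨x, y, k, hk⟩ h
  obtain rfl : x = v := h
  exact ⟨rfl, hk⟩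

end ofAdj

section split

open Classical in
/-- The vertices of a two-fold split at `v`. -/
noncomputable def splitEquiv {V : Type} (v : V) : {w : V // w ≠ v} ⊕ Fin 2 ≃ Option V where
  toFun := Sum.elim (fun w => some w.1) ![some v, none]
  invFun p := p.elim (.inr 1) fun w => if h : w = v then .inr 0 else .inl ⟨w, h⟩
  left_inv := by
    rintro (⟨w, hw⟩ | i)
    · simp [hw]
    · fin_cases i <;> simp
  right_inv := by
    rintro (_ | w)
    · simp
    · by_cases h : w = v <;> simp [h]

theorem nonempty_iso_outSplit (G : CKGraph) (v : G.V) (P : {e : G.E // G.s e = v} → Fin 2)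
    (R : Option G.V → G.V → ℕ∞)
    (h : ∀ x y, x ≠ v → #{e // G.s e = x ∧ G.r e = y} = R (some x) y)
    (h0 : ∀ y, #{e // G.r e = y ∧ ∃ h : G.s e = v, P ⟨e, h⟩ = 0} = R (some v) y)
    (h1 : ∀ y, #{e // G.r e = y ∧ ∃ h : G.s e = v, P ⟨e, h⟩ = 1} = R none y) :
    Nonempty (Iso (G.outSplit v 2 P) (ofAdj fun p q => R p (q.getD v))) := by
  classical
  let lift : G.E → {w : G.V // w ≠ v} ⊕ Fin 2 := fun e =>
    if h : G.s e = v then Sum.inr (P ⟨e, h⟩) else Sum.inl ⟨G.s e, h⟩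
  have hinl : ∀ e, ∀ h : G.r e ≠ v, (G.outSplit v 2 P).s (.inl ⟨e, h⟩) = lift e := by
    intro e h
    simp only [outSplit, lift]
  have hinr : ∀ e, ∀ h : G.r e = v, ∀ j, (G.outSplit v 2 P).s (.inr (⟨e, h⟩, j)) = lift e := by
    intro e h j
    simp only [outSplit, lift]
  have hlift : ∀ p y, #{e // G.r e = y ∧ lift e = p} = R (splitEquiv v p) y := by
    rintro (⟨x, hx⟩ | i) y
    · refine Eq.trans (Cardinal.mk_congr (Equiv.subtypeEquivRight fun e => ?_)) (h x y hx)
      by_cases hs : G.s e = v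
      · have : G.s e ≠ x := fun h' => hx (h'.symm.trans hs)
        simp [lift, hs]
        intro h'
        exact absurd h'.symm hx
      · simp [lift, hs, and_comm]
    · have aux : ∀ e, lift e = .inr i ↔ ∃ h : G.s e = v, P ⟨e, h⟩ = i := by
        intro e
        by_cases hs : G.s e = v <;> simp [lift, hs]
      simp only [aux]
      fin_cases i
      · exact h0 y
      · exact h1 y
  refine nonempty_iso_ofAdj (splitEquiv v) _ ?_
  rintro p (⟨y, hy⟩ | j)
  · refine Eq.trans ?_ (hlift p y)
    symm
    refine Cardinal.mk_congr (Equiv.ofBijective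
      (fun e => ⟨.inl ⟨e.1, fun h => hy (e.2.1.symm.trans h)⟩,
        (hinl _ _).trans e.2.2, congrArg Sum.inl (Subtype.ext e.2.1)⟩) ⟨?_, ?_⟩)
    · rintro ⟨e, he⟩ ⟨f, hf⟩ h
      have h' := Sum.inl.inj (congrArg Subtype.val h)
      have h'' := congrArg Subtype.val h'
      exact Subtype.ext h''
    · rintro ⟨⟨e, he⟩ | ⟨⟨e, he⟩, i⟩, h1, h2⟩
      · rw [hinl] at h1
        exact ⟨⟨e, congrArg Subtype.val (Sum.inl.inj h2), h1⟩, rfl⟩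
      · cases h2
  · have hv : (splitEquiv v (.inr j)).getD v = v := by
      fin_cases j <;> simp [splitEquiv]
    refine Eq.trans ?_ ((hlift p v).trans
      (congrArg (fun w => ((R (splitEquiv v p) w : ℕ∞) : Cardinal)) hv.symm))
    symm
    refine Cardinal.mk_congr (Equiv.ofBijective
      (fun e => ⟨.inr (⟨e.1, e.2.1⟩, j), (hinr _ _ _).trans e.2.2, rfl⟩) ⟨?_, ?_⟩)
    · rintro ⟨e, he⟩ ⟨f, hf⟩ h
      exact Subtype.ext (congrArg (fun t => t.1.1) (Sum.inr.inj (Subtype.mk.inj h)))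
    · rintro ⟨⟨e, he⟩ | ⟨⟨e, he⟩, i⟩, h1, h2⟩
      · cases h2
      · rw [hinr] at h1
        obtain rfl : i = j := Sum.inr.inj h2
        exact ⟨⟨e, he, h1⟩, rfl⟩

theorem nonempty_iso_inSplit (G : CKGraph) (v : G.V) (P : {e : G.E // G.r e = v} → Fin 2)
    (R : Option G.V → G.V → ℕ∞)
    (h : ∀ x y, x ≠ v → #{e // G.s e = y ∧ G.r e = x} = R (some x) y)
    (h0 : ∀ y, #{e // G.s e = y ∧ ∃ h : G.r e = v, P ⟨e, h⟩ = 0} = R (some v) y)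
    (h1 : ∀ y, #{e // G.s e = y ∧ ∃ h : G.r e = v, P ⟨e, h⟩ = 1} = R none y) :
    Nonempty (Iso (G.inSplit v 2 P) (ofAdj fun p q => R q (p.getD v))) := by
  obtain ⟨i⟩ : Nonempty (Iso (G.op.outSplit v 2 P) (ofAdj fun p q : Option G.V =>
    R p (q.getD v))) := nonempty_iso_outSplit G.op v P R
    (fun x y hx => by simpa only [and_comm, op] using h x y hx) h0 h1
  have hs : ∀ e, (G.inSplit v 2 P).r e = (G.op.outSplit v 2 P).s e := by rintro (e | e) <;> rfl
  have hr : ∀ e, (G.inSplit v 2 P).s e = (G.op.outSplit v 2 P).r e := by rintro (e | e) <;> rfl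
  refine nonempty_iso_ofAdj (G := G.inSplit v 2 P) i.vEquiv _ fun x y => ?_
  refine Eq.trans ?_ (mk_fiber_ofAdj (fun p q => R p (q.getD v)) (i.vEquiv y) (i.vEquiv x))
  refine Cardinal.mk_congr (Equiv.subtypeEquiv i.eEquiv fun e =>
    and_comm.trans (and_congr ?_ ?_))
  · exact ⟨fun h => (i.map_s e).trans (congrArg i.vEquiv ((hs e).symm.trans h)),
      fun h => (hs e).trans (i.vEquiv.injective ((i.map_s e).symm.trans h))⟩
  · exact ⟨fun h => (i.map_r e).trans (congrArg i.vEquiv ((hr e).symm.trans h)),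
      fun h => (hr e).trans (i.vEquiv.injective ((i.map_r e).symm.trans h))⟩

variable {V : Type} [Finite V]

open Classical in
theorem moveEquiv_outSplit (A : V → V → ℕ∞) (v : V) (a b : V → ℕ∞)
    (hab : ∀ y, A v y = a y + b y) (ha : ∃ y, a y ≠ 0) (hb : ∃ y, b y ≠ 0)
    (hfin : ∀ y, b y ≠ ⊤) :
    MoveEquiv (ofAdj A) (ofAdj fun p q : Option V =>
      (p.elim b fun x => if x = v then a else A x : V → ℕ∞) (q.getD v)) := by
  let P : {e : (ofAdj A).E // (ofAdj A).s e = v} → Fin 2 := fun e =>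
    if (e.1.2.2.1 : ℕ∞) < b e.1.2.1 then 1 else 0
  obtain ⟨y₀, hy₀⟩ := ha
  obtain ⟨y₁, hy₁⟩ := hb
  have hsurj : Function.Surjective P := by
    intro i
    fin_cases i
    · obtain ⟨k, hk⟩ := ENat.ne_top_iff_exists.1 (hfin y₀)
      refine ⟨⟨⟨v, y₀, k, ?_⟩, rfl⟩, ?_⟩
      · rw [hab, hk]
        exact ENat.lt_add_left (hfin y₀) (pos_iff_ne_zero.2 hy₀)
      · simp [P, hk]
    · refine ⟨⟨⟨v, y₁, 0, ?_⟩, rfl⟩, ?_⟩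
      · rw [hab]
        simp [pos_iff_ne_zero, hy₁]
      · simp [P, pos_iff_ne_zero, hy₁]
  have hP1 : ¬ {x | P x = 1}.Infinite := by
    rw [Set.not_infinite]
    refine Set.Finite.of_finite_image (f := Subtype.val)
      ((finite_ofAdj_edges v b hfin).subset ?_) Subtype.val_injective.injOn
    rintro _ ⟨⟨e, he⟩, h, rfl⟩
    refine ⟨he, ?_⟩
    by_contra hc
    simp [P, hc] at h
  have hP : ∀ i, {x | P x = i}.Infinite → i = 0 := by
    intro i hi
    fin_cases i
    · rfl
    · exact absurd hi hP1
  refine .moveO (G := ofAdj A) ‹_› v ?_ 2 P hsurj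
    (fun i j hi hj => (hP i hi).trans (hP j hj).symm)
    ((nonempty_iso_outSplit (ofAdj A) v P
      (fun p => (p.elim b fun x => if x = v then a else A x : V → ℕ∞)) ?_ ?_ ?_).map Iso.inv)
  · intro h
    obtain ⟨e, -⟩ := hsurj 0
    exact h e.1 e.2
  · intro x y hx
    rw [mk_fiber_ofAdj]
    simp [hx]
  · intro y
    have := mk_edges_ofAdj A v y fun e => ¬ (e.2.2.1 : ℕ∞) < b e.2.1
    simp only [exists_prop, hab, mk_lt_add _ (hfin y)] at this
    simp only [Option.elim_some, if_true]
    rw [← this]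
    refine Cardinal.mk_congr (Equiv.subtypeEquivRight fun e => ?_)
    by_cases h : (e.2.2.1 : ℕ∞) < b e.2.1 <;> simp [P, h, and_comm]
  · intro y
    have := mk_edges_ofAdj A v y fun e => (e.2.2.1 : ℕ∞) < b e.2.1
    simp only [exists_prop, hab, mk_lt_add'] at this
    simp only [Option.elim_none]
    rw [← this]
    refine Cardinal.mk_congr (Equiv.subtypeEquivRight fun e => ?_)
    by_cases h : (e.2.2.1 : ℕ∞) < b e.2.1 <;> simp [P, h, and_comm]

open Classical in
theorem moveEquiv_inSplit (A : V → V → ℕ∞) (v : V) (a b : V → ℕ∞)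
    (hab : ∀ x, A x v = a x + b x) (ha : ∃ x, a x ≠ 0) (hb : ∃ x, b x ≠ 0)
    (hfin : ∀ x, b x ≠ ⊤) (h0 : ∃ y, A v y ≠ 0) (hrow : ∀ y, A v y ≠ ⊤) :
    MoveEquiv (ofAdj A) (ofAdj fun p q : Option V =>
      (q.elim b fun y => if y = v then a else fun x => A x y : V → ℕ∞) (p.getD v)) := by
  let P : {e : (ofAdj A).E // (ofAdj A).r e = v} → Fin 2 := fun e =>
    if (e.1.2.2.1 : ℕ∞) < b e.1.1 then 1 else 0
  obtain ⟨x₀, hx₀⟩ := ha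
  obtain ⟨x₁, hx₁⟩ := hb
  have hsurj : Function.Surjective P := by
    intro i
    fin_cases i
    · obtain ⟨k, hk⟩ := ENat.ne_top_iff_exists.1 (hfin x₀)
      refine ⟨⟨⟨x₀, v, k, ?_⟩, rfl⟩, ?_⟩
      · rw [hab, hk]
        exact ENat.lt_add_left (hfin x₀) (pos_iff_ne_zero.2 hx₀)
      · simp [P, hk]
    · refine ⟨⟨⟨x₁, v, 0, ?_⟩, rfl⟩, ?_⟩
      · rw [hab]
        simp [pos_iff_ne_zero, hx₁]
      · simp [P, pos_iff_ne_zero, hx₁]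
  refine .moveI (G := ofAdj A) ‹_› v (regular_ofAdj h0 hrow) ?_ 2 P hsurj
    ((nonempty_iso_inSplit (ofAdj A) v P
      (fun q => (q.elim b fun y => if y = v then a else fun x => A x y : V → ℕ∞))
      ?_ ?_ ?_).map Iso.inv)
  · intro h
    obtain ⟨e, -⟩ := hsurj 0
    exact h e.1 e.2
  · intro y x hy
    rw [mk_fiber_ofAdj]
    simp [hy]
  · intro x
    have := mk_edges_ofAdj A x v fun e => ¬ (e.2.2.1 : ℕ∞) < b e.1
    simp only [exists_prop, hab, mk_lt_add _ (hfin x)] at this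
    simp only [Option.elim_some, if_true]
    rw [← this]
    refine Cardinal.mk_congr (Equiv.subtypeEquivRight fun e => ?_)
    by_cases h : (e.2.2.1 : ℕ∞) < b e.1 <;> simp [P, h, and_comm]
  · intro x
    have := mk_edges_ofAdj A x v fun e => (e.2.2.1 : ℕ∞) < b e.1
    simp only [exists_prop, hab, mk_lt_add'] at this
    simp only [Option.elim_none]
    rw [← this]
    refine Cardinal.mk_congr (Equiv.subtypeEquivRight fun e => ?_)
    by_cases h : (e.2.2.1 : ℕ∞) < b e.1 <;> simp [P, h, and_comm]

end split

section reduce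

open Classical in
theorem mk_fiber_reduce (G : CKGraph) (u : G.V) (f : G.E) (hf : G.s f = u) (hrf : G.r f ≠ u)
    (honly : ∀ e, G.s e = u → e = f) (v : G.V) (hin : ∀ e, G.r e = u → G.s e = v)
    (p q : {w : G.V // w ≠ u}) :
    #{e // (G.reduce u f hf hrf honly v hin).s e = p ∧
        (G.reduce u f hf hrf honly v hin).r e = q} =
      #{e // G.s e = p.1 ∧ G.r e = q.1} +
        if G.r f = q.1 then #{e // G.s e = p.1 ∧ G.r e = u} else 0 := by
  refine (Cardinal.mk_congr (Equiv.subtypeSum (α := {e : G.E // G.r e ≠ u ∧ e ≠ f})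
    (β := {e : G.E // G.r e = u}))).trans ((Cardinal.add_def _ _).symm.trans
      (congrArg₂ (· + ·) ?_ ?_))
  · symm
    refine Cardinal.mk_congr (Equiv.ofBijective
      (fun e => ⟨⟨e.1, fun h => q.2 (e.2.2.symm.trans h), fun h => p.2 ?_⟩,
        Subtype.ext e.2.1, Subtype.ext e.2.2⟩) ⟨?_, ?_⟩)
    · rw [← e.2.1, h, hf]
    · rintro ⟨e, he⟩ ⟨e', he'⟩ h
      have h' := congrArg (fun t => t.1.1) h
      exact Subtype.ext h'
    · rintro ⟨⟨e, he⟩, h1, h2⟩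
      exact ⟨⟨e, congrArg Subtype.val h1, congrArg Subtype.val h2⟩, rfl⟩
  · split_ifs with hq
    · symm
      refine Cardinal.mk_congr (Equiv.ofBijective
        (fun e => ⟨⟨e.1, e.2.2⟩, Subtype.ext e.2.1, Subtype.ext hq⟩) ⟨?_, ?_⟩)
      · rintro ⟨e, he⟩ ⟨e', he'⟩ h
        have h' := congrArg (fun t => t.1.1) h
        exact Subtype.ext h'
      · rintro ⟨⟨e, he⟩, h1, h2⟩
        exact ⟨⟨e, congrArg Subtype.val h1, he⟩, rfl⟩
    · refine Cardinal.mk_eq_zero_iff.2 ⟨?_⟩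
      rintro ⟨⟨e, he⟩, h1, h2⟩
      exact hq (congrArg Subtype.val h2)

open Classical in
theorem nonempty_iso_reduce (G : CKGraph) (u : G.V) (f : G.E) (hf : G.s f = u)
    (hrf : G.r f ≠ u) (honly : ∀ e, G.s e = u → e = f) (v : G.V)
    (hin : ∀ e, G.r e = u → G.s e = v) {W : Type} (φ : {w : G.V // w ≠ u} ≃ W)
    (A : W → W → ℕ∞)
    (h : ∀ p q, #{e // G.s e = p.1 ∧ G.r e = q.1} +
      (if G.r f = q.1 then #{e // G.s e = p.1 ∧ G.r e = u} else 0) = A (φ p) (φ q)) :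
    Nonempty (Iso (G.reduce u f hf hrf honly v hin) (ofAdj A)) :=
  nonempty_iso_ofAdj (G := G.reduce u f hf hrf honly v hin) φ A fun p q =>
    (mk_fiber_reduce G u f hf hrf honly v hin p q).trans (h p q)

variable {V : Type}

open Classical in
/-- The adjacency function obtained from `A` by adding a vertex `none` which receives exactly
one edge, from `x`, and emits edges according to `b`. -/
noncomputable def detour (A : V → V → ℕ∞) (x : V) (b : V → ℕ∞) : Option V → Option V → ℕ∞
  | some p, some q => A p q
  | some p, none => if p = x then 1 else 0
  | none, some q => b q
  | none, none => 0

variable [Finite V]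

open Classical in
theorem moveEquiv_reduce (A : V → V → ℕ∞) (x z : V) :
    MoveEquiv (ofAdj (detour A x fun q => if q = z then 1 else 0))
      (ofAdj fun p q => A p q + if p = x ∧ q = z then 1 else 0) := by
  obtain ⟨D, hD⟩ : ∃ D, D = detour A x fun q => if q = z then 1 else 0 := ⟨_, rfl⟩
  rw [← hD]
  let f : (ofAdj D).E := ⟨none, some z, 0, by simp [hD, detour]⟩
  have honly : ∀ e : (ofAdj D).E, (ofAdj D).s e = none → e = f := by
    rintro ⟨p, q, k, hk⟩ h
    obtain rfl : p = none := h
    rcases q with _ | q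
    · simp [hD, detour] at hk
    · by_cases hq : q = z
      · subst hq
        obtain rfl : k = 0 := by simpa [hD, detour] using hk
        rfl
      · simp [hD, detour, hq] at hk
  have hin : ∀ e : (ofAdj D).E, (ofAdj D).r e = none → (ofAdj D).s e = some x := by
    rintro ⟨p, q, k, hk⟩ h
    obtain rfl : q = none := h
    rcases p with _ | p
    · simp [hD, detour] at hk
    · by_cases hp : p = x
      · exact congrArg some hp
      · simp [hD, detour, hp] at hk
  obtain ⟨φ, hφ⟩ : ∃ φ : {w : Option V // w ≠ none} ≃ V, ∀ p, p.1 = some (φ p) :=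
    ⟨⟨fun p => p.1.get (Option.isSome_iff_ne_none.2 p.2), fun v => ⟨some v, by simp⟩,
      fun p => by simp, fun v => by simp⟩, fun p => by simp⟩
  have hrf : (ofAdj D).r f = some z := rfl
  refine .moveR (G := ofAdj D) inferInstance none f rfl (Option.some_ne_none z) honly (some x) hin
    ((nonempty_iso_reduce (ofAdj D) none f rfl (Option.some_ne_none z) honly (some x) hin
      φ _ fun p q => ?_).map Iso.inv)
  rw [hφ p, hφ q, mk_fiber_ofAdj, mk_fiber_ofAdj, hrf]
  simp only [hD, detour, Option.some.injEq, eq_comm (a := z)]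
  by_cases h1 : φ p = x <;> by_cases h2 : φ q = z <;> simp [h1, h2]

/-- A vertex which receives a single edge, emits finitely many edges and supports no loop
may be removed, replacing the paths of length two through it by edges. -/
theorem moveEquiv_detour (A : V → V → ℕ∞) (x : V) (b : V → ℕ) (hb : ∃ y, b y ≠ 0) :
    MoveEquiv (ofAdj (detour A x fun q => b q))
      (ofAdj (open Classical in fun p q => A p q + if p = x then (b q : ℕ∞) else 0)) := by
  classical
  have := Fintype.ofFinite V
  obtain ⟨n, hn⟩ : ∃ n, ∑ y, b y = n := ⟨_, rfl⟩
  induction n generalizing A b with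
  | zero =>
    obtain ⟨y, hy⟩ := hb
    exact absurd (Finset.sum_eq_zero_iff.1 hn y (Finset.mem_univ y)) hy
  | succ n ih =>
    obtain ⟨z, hz⟩ := hb
    obtain ⟨b', rfl⟩ : ∃ b', b = b' + Pi.single z 1 := by
      refine ⟨b - Pi.single z 1, (tsub_add_cancel_of_le ?_).symm⟩
      intro y
      by_cases hy : y = z
      · subst hy
        simpa using Nat.one_le_iff_ne_zero.2 hz
      · simp [hy]
    have hn' : ∑ y, b' y = n := by
      simpa [Finset.sum_add_distrib] using hn
    by_cases hb' : ∃ y, b' y ≠ 0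
    · refine (moveEquiv_outSplit _ none (fun q => q.elim 0 fun q => b' q)
        (fun q => if q = some z then 1 else 0) ?_ ?_ ?_ ?_).trans
        ((moveEquiv_of_eq ?_).trans ((moveEquiv_reduce (detour A x fun q => b' q)
          (some x) (some z)).trans ((moveEquiv_of_eq ?_).trans ((ih
            (fun p q => A p q + if p = x ∧ q = z then 1 else 0) b' hb' hn').trans
              (moveEquiv_of_eq ?_)))))
      · rintro (_ | q)
        · simp [detour]
        · simp [detour, Pi.single_apply]
      · obtain ⟨y, hy⟩ := hb'
        exact ⟨some y, by simpa using hy⟩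
      · exact ⟨some z, by simp⟩
      · intro q
        split_ifs <;> simp
      · rintro (_ | _ | p) (_ | _ | q) <;> simp [detour]
      · rintro (_ | p) (_ | q) <;> simp [detour]
      · intro p q
        by_cases h1 : p = x <;> by_cases h2 : q = z <;>
          simp [h1, h2, add_comm, add_left_comm]
    · push Not at hb'
      obtain rfl : b' = 0 := funext hb'
      refine .trans (moveEquiv_of_eq ?_) ((moveEquiv_reduce A x z).trans (moveEquiv_of_eq ?_))
      · rintro (_ | p) (_ | q) <;> simp [detour, Pi.single_apply]
      · intro p q
        by_cases h1 : p = x <;> by_cases h2 : q = z <;> simp [h1, h2]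

open Classical in
/-- An edge from `x` to a regular vertex `y ≠ x` may be replaced by edges from `x` to the
ranges of all edges emitted by `y`, if it is not the only edge into `y`. -/
theorem moveEquiv_rowAdd (A : V → V → ℕ∞) {x y : V} (hxy : x ≠ y) (b : V → ℕ)
    (hb : ∀ q, A y q = b q) (hb0 : ∃ q, b q ≠ 0) (hcol : ∃ p, A p y ≠ 0) :
    MoveEquiv (ofAdj fun p q => A p q + if p = x ∧ q = y then 1 else 0)
      (ofAdj fun p q => A p q + if p = x then (b q : ℕ∞) else 0) := by
  refine (moveEquiv_inSplit _ y (fun p => A p y) (fun p => if p = x then 1 else 0)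
    ?_ hcol ⟨x, by simp⟩ ?_ ?_ ?_).trans
    ((moveEquiv_of_eq ?_).trans (moveEquiv_detour A x b hb0))
  · simp
  · intro p
    split_ifs <;> simp
  · obtain ⟨q, hq⟩ := hb0
    exact ⟨q, by simpa [hb, hxy.symm] using hq⟩
  · simp [hb, hxy.symm]
  · rintro (_ | p) (_ | q)
    · simp [detour, hxy.symm]
    · by_cases h : q = y <;> simp [detour, h, hb, hxy.symm]
    · simp [detour]
    · by_cases h : q = y <;> simp [detour, h]

end reduce

section extended

variable {R S : Type}

open Classical in
/-- The adjacency function on `R ⊕ S` whose rows in `R` are those of the identity plus `B`,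
and all whose other entries are infinite. -/
noncomputable def extended (B : R → R ⊕ S → ℕ) : R ⊕ S → R ⊕ S → ℕ∞ :=
  Sum.elim (fun x q => (B x q : ℕ∞) + if q = .inl x then 1 else 0) fun _ _ => ⊤

open Classical in
/-- The rows obtained from `B` by splitting a new regular vertex off the vertex `u`. -/
noncomputable def splitRows (B : R → R ⊕ S → ℕ) (u : S) : Option R → Option R ⊕ S → ℕ :=
  fun p q => p.elim (if q = .inr u then 2 else 1) fun x =>
    B x (q.elim (fun y => y.elim (.inr u) .inl) .inr)

theorem splitRows_ne_zero {B : R → R ⊕ S → ℕ} (hB : ∀ x q, B x q ≠ 0) (u : S) (p q) :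
    splitRows B u p q ≠ 0 := by
  rcases p with _ | x
  · simp only [splitRows, Option.elim_none]
    split_ifs <;> simp
  · exact hB _ _

theorem splitRows_none_none (B : R → R ⊕ S → ℕ) (u : S) :
    splitRows B u none (.inl none) = 1 := by
  simp [splitRows]

theorem moveEquiv_splitRows [Finite R] [Finite S] (B : R → R ⊕ S → ℕ) (u : S) :
    MoveEquiv (ofAdj (extended B)) (ofAdj (extended (splitRows B u))) := by
  classical
  let φ : Option (R ⊕ S) ≃ Option R ⊕ S :=
    { toFun := fun p => p.elim (.inl none) (Sum.elim (fun x => .inl (some x)) .inr)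
      invFun := Sum.elim (fun p => p.elim none fun x => some (.inl x)) fun s => some (.inr s)
      left_inv := by rintro (_ | _ | _) <;> rfl
      right_inv := by rintro ((_ | _) | _) <;> rfl }
  refine (moveEquiv_outSplit _ (.inr u) (fun _ => ⊤) (fun q => if q = .inr u then 2 else 1)
    ?_ ⟨.inr u, by simp⟩ ⟨.inr u, by simp⟩ ?_).trans (moveEquiv_ofAdj_reindex φ ?_)
  · intro q
    simp [extended]
  · intro q
    split_ifs <;> simp
  · rintro (_ | x | s) (_ | y | t)
    · simp [φ, extended, splitRows, one_add_one_eq_two]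
    · simp [φ, extended, splitRows]
    · by_cases h : t = u <;> simp [φ, extended, splitRows, h]
    · simp [φ, extended, splitRows]
    · simp [φ, extended, splitRows]
    · simp [φ, extended, splitRows]
    · by_cases h : s = u <;> simp [φ, extended, h]
    · by_cases h : s = u <;> simp [φ, extended, h]
    · by_cases h : s = u <;> simp [φ, extended, h]

open Classical in
theorem moveEquiv_update_add [Finite R] [Finite S] (B : R → R ⊕ S → ℕ) {y z : R} (hyz : y ≠ z)
    (h : B y (.inl z) ≠ 0) :
    MoveEquiv (ofAdj (extended B)) (ofAdj (extended (Function.update B y (B y + B z)))) := by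
  obtain ⟨c, hc⟩ : ∃ c : R ⊕ S → ℕ, B y = c + Pi.single (Sum.inl z : R ⊕ S) 1 := by
    refine ⟨B y - Pi.single (.inl z) 1, (tsub_add_cancel_of_le ?_).symm⟩
    intro q
    by_cases hq : q = .inl z
    · subst hq
      simpa using Nat.one_le_iff_ne_zero.2 h
    · simp [hq]
  refine (moveEquiv_of_eq ?_).trans ((moveEquiv_rowAdd (extended (Function.update B y c))
    (x := .inl y) (y := .inl z) (by simpa using hyz) (B z + Pi.single (.inl z) 1) ?_ ?_
      ⟨.inl z, by simp [extended]⟩).trans (moveEquiv_of_eq ?_))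
  · rintro (p | s) q
    · by_cases hp : p = y
      · subst hp
        by_cases hq : q = .inl z <;>
          simp [extended, hc, hq, add_comm, add_left_comm]
      · simp [extended, hp]
    · simp [extended]
  · intro q
    by_cases hq : q = .inl z <;> simp [extended, hyz.symm, hq]
  · exact ⟨.inl z, by simp⟩
  · rintro (p | s) q
    · by_cases hp : p = y
      · subst hp
        by_cases hq : q = .inl z <;> simp [extended, hc, hq] <;> ring
      · simp [extended, hp]
    · simp [extended]

theorem exists_step {α : Type*} {r : α → α → Prop} {P : α → Prop} {x w : α}
    (h : Relation.ReflTransGen r x w) (hx : ¬ P x) (hw : P w) : ∃ y z, ¬ P y ∧ P z ∧ r y z := by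
  induction h using Relation.ReflTransGen.head_induction_on with
  | refl => exact absurd hw hx
  | @head a c hac _ ih =>
    by_cases hc : P c
    · exact ⟨a, c, hx, hc, hac⟩
    · exact ih hc

/-- If every regular vertex connects to one whose row is positive, then all rows can be made
positive. -/
theorem exists_forall_ne_zero [Finite R] [Finite S] (B : R → R ⊕ S → ℕ) (w : R)
    (hw : ∀ q, B w q ≠ 0)
    (hpath : ∀ x, Relation.ReflTransGen (fun x y => B x (.inl y) ≠ 0) x w) :
    ∃ B' : R → R ⊕ S → ℕ, (∀ x q, B' x q ≠ 0) ∧ B' w = B w ∧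
      MoveEquiv (ofAdj (extended B)) (ofAdj (extended B')) := by
  classical
  obtain ⟨n, hn⟩ : ∃ n, {x | ¬ ∀ q, B x q ≠ 0}.ncard = n := ⟨_, rfl⟩
  induction n using Nat.strong_induction_on generalizing B with
  | _ n ih =>
    by_cases hpos : ∀ x q, B x q ≠ 0
    · exact ⟨B, hpos, rfl, moveEquiv_of_eq fun _ _ => rfl⟩
    obtain ⟨x, hx⟩ := not_forall.1 hpos
    obtain ⟨y, z, hy, hz, hyz⟩ := exists_step (P := fun x => ∀ q, B x q ≠ 0) (hpath x) hx hw
    have hne : y ≠ z := fun h => hy (h ▸ hz)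
    have hwy : w ≠ y := fun h => hy (h ▸ hw)
    have hle : ∀ x q, B x q ≤ Function.update B y (B y + B z) x q := by
      intro x q
      by_cases hxy : x = y
      · subst hxy
        simp
      · simp [hxy]
    have hle' : ∀ x q, B x q ≠ 0 → Function.update B y (B y + B z) x q ≠ 0 :=
      fun x q h h0 => h (Nat.le_zero.1 (h0 ▸ hle x q))
    have hlt : {x | ¬ ∀ q, Function.update B y (B y + B z) x q ≠ 0}.ncard < n := by
      rw [← hn]
      refine Set.ncard_lt_ncard ((Set.ssubset_iff_of_subset ?_).2
        ⟨y, hy, fun h => h fun q => ?_⟩)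
      · exact fun x hx h => hx fun q => hle' x q (h q)
      · simpa using fun _ => hz q
    obtain ⟨B', h1, h2, h3⟩ := ih _ hlt
      (Function.update B y (B y + B z)) (fun q => hle' w q (hw q))
      (fun x => Relation.ReflTransGen.mono (fun a b hab => hle' a _ hab) _ _ (hpath x)) rfl
    exact ⟨B', h1, h2.trans (Function.update_of_ne hwy _ _),
      (moveEquiv_update_add B hne hyz).trans h3⟩

/-- If every regular vertex connects to one with an edge to `u`, then all rows can be made
positive after splitting a vertex off `u`. -/
theorem exists_forall_ne_zero_option [Finite R] [Finite S] (B : R → R ⊕ S → ℕ) (u : S)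
    (hpath : ∀ x, ∃ x₀, B x₀ (.inr u) ≠ 0 ∧
      Relation.ReflTransGen (fun x y => B x (.inl y) ≠ 0) x x₀) :
    ∃ B' : Option R → Option R ⊕ S → ℕ, (∀ x q, B' x q ≠ 0) ∧ (∃ x q, B' x q = 1) ∧
      MoveEquiv (ofAdj (extended B)) (ofAdj (extended B')) := by
  obtain ⟨B', h1, h2, h3⟩ := exists_forall_ne_zero (splitRows B u) none
    (fun q => by simp only [splitRows, Option.elim_none]; split_ifs <;> simp) (by
      rintro (_ | x)
      · exact .refl
      · obtain ⟨x₀, h₀, h⟩ := hpath x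
        exact (h.lift some fun a b hab => hab).tail h₀)
  exact ⟨B', h1, ⟨none, .inl none, by rw [h2, splitRows_none_none]⟩,
    (moveEquiv_splitRows B u).trans h3⟩

/-- Positive rows can be enlarged by any number of further regular vertices. -/
theorem exists_enlarge [Fintype R] [Finite S] (u : S) (p : ℕ) (B : R → R ⊕ S → ℕ)
    (hB : ∀ x q, B x q ≠ 0) (hB1 : ∃ x q, B x q = 1) :
    ∃ (R' : Type) (_ : Fintype R') (B' : R' → R' ⊕ S → ℕ), Fintype.card R' = Fintype.card R + p ∧
      (∀ x q, B' x q ≠ 0) ∧ (∃ x q, B' x q = 1) ∧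
      MoveEquiv (ofAdj (extended B)) (ofAdj (extended B')) := by
  induction p generalizing R with
  | zero => exact ⟨R, ‹_›, B, rfl, hB, hB1, moveEquiv_of_eq fun _ _ => rfl⟩
  | succ p ih =>
    obtain ⟨R', i, B', h, h1, h2, h3⟩ := ih (splitRows B u) (splitRows_ne_zero hB u)
      ⟨none, .inl none, splitRows_none_none B u⟩
    exact ⟨R', i, B', by rw [h, Fintype.card_option]; omega, h1, h2,
      (moveEquiv_splitRows B u).trans h3⟩

theorem moveEquiv_graphOfMatrix {N r : ℕ} (E : R ⊕ S ≃ Fin N)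
    (hR : ∀ x, (E (.inl x)).1 < r) (hS : ∀ s, r ≤ (E (.inr s)).1)
    (B : Matrix (Fin N) (Fin N) ℕ) :
    MoveEquiv (ofAdj (extended fun x q => B (E (.inl x)) (E q)))
      (graphOfMatrix (Jmat N r + B.map ((↑) : ℕ → ℕ∞))) := by
  have : Finite (R ⊕ S) := Finite.of_equiv _ E.symm
  classical
  have key : ∀ p q, extended (fun x q => B (E (.inl x)) (E q)) p q =
      (Jmat N r + B.map ((↑) : ℕ → ℕ∞)) (E p) (E q) := by
    rintro (x | s) q
    · have h : E (.inl x) = E q ↔ q = .inl x := E.apply_eq_iff_eq.trans eq_comm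
      simpa [extended, Jmat, hR, add_comm] using if_congr h.symm rfl rfl
    · simp [extended, Jmat, (hS s).not_gt]
  exact moveEquiv_ofAdj_reindex E key

end extended

end CKGraph

theorem exists_lt_le_of_irreducible {m N : ℕ} {A : Matrix (Fin N) (Fin N) ℕ∞}
    (hA : MatIrreducible A) {i j : Fin N} (hi : i.1 < m) (hj : m ≤ j.1) :
    ∃ x y : Fin N, x.1 < m ∧ m ≤ y.1 ∧ A x y ≠ 0 := by
  obtain ⟨l, c, -, rfl, rfl, hc⟩ := hA i j
  by_contra! h
  have key : ∀ t ≤ l, (c t).1 < m := by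
    intro t
    induction t with
    | zero => exact fun _ => hi
    | succ t ih =>
      intro ht
      by_contra! h'
      exact hc t ht (h _ _ (ih (by omega)) h')
  exact absurd (key l le_rfl) (not_lt.2 hj)

theorem reflTransGen_of_irreducible {N : ℕ} {A : Matrix (Fin N) (Fin N) ℕ∞}
    (hA : MatIrreducible A) {r : Fin N → Fin N → Prop} (hr : ∀ x y, A x y ≠ 0 → x ≠ y → r x y)
    (i j : Fin N) : Relation.ReflTransGen r i j := by
  obtain ⟨l, c, -, rfl, rfl, hc⟩ := hA i j
  clear hA
  induction l with
  | zero => exact .refl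
  | succ l ih =>
    have h := ih fun t ht => hc t (by omega)
    by_cases he : c l = c (l + 1)
    · rwa [← he]
    · exact h.tail (hr _ _ (hc l (by omega)) he)

/-- `J_{nm} + B` can be enlarged to any size `k ≥ n + 2`. -/
theorem stmt12 {n m : ℕ} (hmn : m < n) (B : Matrix (Fin n) (Fin n) ℕ)
    (hzero : ∀ i : Fin n, m ≤ i.1 → ∀ j, B i j = 0)
    (hirr : MatIrreducible (Jmat n m + B.map ((↑) : ℕ → ℕ∞)))
    (hcorner : MatIrreducible ((Jmat n m + B.map ((↑) : ℕ → ℕ∞)).submatrix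
      (Fin.castLE hmn.le) (Fin.castLE hmn.le)))
    (k : ℕ) (hk : n + 2 ≤ k) :
    ∃ C : Matrix (Fin k) (Fin k) ℕ,
      (∀ i : Fin k, i.1 < k - (n - m) → ∀ j, C i j ≠ 0) ∧
      (∃ i j, C i j = 1) ∧
      (∀ i : Fin k, k - (n - m) ≤ i.1 → ∀ j, C i j = 0) ∧
      MatMoveEquiv (Jmat n m + B.map ((↑) : ℕ → ℕ∞))
        (Jmat k (k - (n - m)) + C.map ((↑) : ℕ → ℕ∞)) := by
  classical
  let E₀ : Fin m ⊕ Fin (n - m) ≃ Fin n := finSumFinEquiv.trans (finCongr (by omega))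
  have hE₀ : ∀ x, E₀ (.inl x) = Fin.castLE hmn.le x := fun _ => rfl
  have hE₀' : ∀ s, (E₀ (.inr s)).1 = m + s.1 := fun _ => rfl
  obtain ⟨u, hu⟩ : ∃ u : Fin (n - m), ∀ x : Fin m, ∃ x₀, B (E₀ (.inl x₀)) (E₀ (.inr u)) ≠ 0 ∧
      Relation.ReflTransGen (fun x y => B (E₀ (.inl x)) (E₀ (.inl y)) ≠ 0) x x₀ := by
    rcases Nat.eq_zero_or_pos m with hm | hm
    · exact ⟨⟨0, by omega⟩, fun x => absurd x.2 (by omega)⟩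
    obtain ⟨a, b, ha, hb, hab⟩ := exists_lt_le_of_irreducible (m := m) hirr
      (i := ⟨0, by omega⟩) (j := ⟨m, hmn⟩) hm le_rfl
    have hne : a ≠ b := by
      rintro rfl
      omega
    refine ⟨⟨b - m, by omega⟩, fun x => ⟨⟨a, ha⟩, ?_, reflTransGen_of_irreducible hcorner ?_ _ _⟩⟩
    · have h : E₀ (.inr ⟨b - m, by omega⟩) = b := Fin.ext (by rw [hE₀']; simp; omega)
      rw [h]
      simpa [Jmat, ha, hne, hE₀] using hab
    · intro y z hyz hne
      simpa [Jmat, hne, hE₀] using hyz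
  obtain ⟨B₁, h1, h2, h3⟩ := CKGraph.exists_forall_ne_zero_option
    (fun x q => B (E₀ (.inl x)) (E₀ q)) u hu
  obtain ⟨R, _, B₂, hcard, h4, ⟨x₁, q₁, h5⟩, h6⟩ :=
    CKGraph.exists_enlarge u (k - n - 1) B₁ h1 h2
  have hcard' : Fintype.card R = k - (n - m) := by
    rw [hcard, Fintype.card_option, Fintype.card_fin]
    omega
  let E : R ⊕ Fin (n - m) ≃ Fin k :=
    (Equiv.sumCongr (Fintype.equivFinOfCardEq hcard') (Equiv.refl _)).trans
      (finSumFinEquiv.trans (finCongr (by omega)))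
  have hER : ∀ x, (E (.inl x)).1 < k - (n - m) := fun x =>
    (Fintype.equivFinOfCardEq hcard' x).2
  have hES : ∀ s, k - (n - m) ≤ (E (.inr s)).1 := fun s => Nat.le_add_right _ _
  let C : Matrix (Fin k) (Fin k) ℕ := fun i j =>
    Sum.elim (fun x => B₂ x (E.symm j)) (fun _ => 0) (E.symm i)
  have hC : ∀ x q, C (E (.inl x)) (E q) = B₂ x q := fun x q => by simp [C]
  refine ⟨C, ?_, ⟨E (.inl x₁), E q₁, (hC _ _).trans h5⟩, ?_, ?_⟩
  · intro i hi j
    obtain ⟨x | s, rfl⟩ := E.surjective i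
    · obtain ⟨q, rfl⟩ := E.surjective j
      rw [hC]
      exact h4 x q
    · exact absurd (hES s) (not_le.2 hi)
  · intro i hi j
    obtain ⟨x | s, rfl⟩ := E.surjective i
    · exact absurd hi (not_le.2 (hER x))
    · simp [C]
  · refine (CKGraph.moveEquiv_graphOfMatrix E₀ (fun x => x.2)
      (fun s => Nat.le_add_right _ _) B).symm.trans (h3.trans (h6.trans ?_))
    have h7 := CKGraph.moveEquiv_graphOfMatrix E hER hES C
    simpa only [hC] using h7
end

section
/- Let n > m ≥ 0 and let C be an n×n matrix whose entries in the first m rows are non-zero (finite) non-negative integers, whose last n−m rows are zero, and which has at least one entry equal to 1; set A = J_{nm} + C. Then there exists an (n+2)×(n+2) matrix D such that: (i) the last n−m rows of D are identically zero; (ii) every entry in the first m+2 rows of D is strictly positive; (iii) D(i,1) = 1 for all 1 ≤ i ≤ m+2; (iv) the determinant of the top-left (m+2)×(m+2) corner of D is zero; and (v) J_{nm} + C ∼_M J_{(n+2),(m+2)} + D. -/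
namespace CKGraph

/-- The graph whose edges are grouped into families indexed by `I`: the `i`-th family consists
of `f i` edges from `s i` to `r i`. -/
def familyGraph {I X : Type} (s r : I → X) (f : I → ℕ∞) : CKGraph where
  V := X
  E := Σ i : I, {k : ℕ // (k : ℕ∞) < f i}
  r e := r e.1
  s e := s e.1

/-- The graph with vertex set `X` and `A x y` edges from `x` to `y`. -/
def matGraph {X : Type} (A : X → X → ℕ∞) : CKGraph :=
  familyGraph (I := X × X) Prod.fst Prod.snd (fun p => A p.1 p.2)

theorem card_subtype_lt (a : ℕ∞) : ENat.card {k : ℕ // (k : ℕ∞) < a} = a := by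
  induction a using ENat.recTopCoe with
  | top =>
    rw [ENat.card_congr (Equiv.subtypeUnivEquiv fun k => ENat.natCast_lt_top k)]
    simp
  | coe n =>
    simp only [Nat.cast_lt]
    rw [ENat.card_congr Fin.equivSubtype.symm]
    simp

theorem nonempty_equiv_of_card_eq {α β : Type} [Countable α] [Countable β]
    (h : ENat.card α = ENat.card β) : Nonempty (α ≃ β) := by
  rcases finite_or_infinite α with hα | hα <;> rcases finite_or_infinite β with hβ | hβ
  · rw [ENat.card_eq_coe_natCard, ENat.card_eq_coe_natCard] at h
    exact Finite.card_eq.1 (by exact_mod_cast h)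
  · simp [ENat.card_eq_coe_natCard α] at h
  · simp [ENat.card_eq_coe_natCard β] at h
  · exact nonempty_equiv_of_countable

theorem enatCard_sigma {I : Type} [Fintype I] (F : I → Type) :
    ENat.card (Σ i, F i) = ∑ i, ENat.card (F i) := by
  by_cases h : ∀ i, Finite (F i)
  · rw [ENat.card_eq_coe_natCard, Nat.card_sigma]
    push_cast
    exact Finset.sum_congr rfl fun i _ => (ENat.card_eq_coe_natCard _).symm
  · push Not at h
    obtain ⟨i, hi⟩ := h
    have : Infinite (Σ i, F i) := Infinite.of_injective (Sigma.mk i) sigma_mk_injective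
    rw [ENat.card_eq_top_of_infinite, eq_comm, ← top_le_iff,
      ← ENat.card_eq_top_of_infinite (α := F i)]
    exact Finset.single_le_sum (f := fun i => ENat.card (F i)) (fun _ _ => zero_le)
      (Finset.mem_univ i)

theorem card_familyGraph_edges {I X : Type} [Fintype I] [DecidableEq X] (s r : I → X)
    (f : I → ℕ∞) (x y : X) :
    ENat.card {e : (familyGraph s r f).E //
      (familyGraph s r f).s e = x ∧ (familyGraph s r f).r e = y} =
      ∑ i, if s i = x ∧ r i = y then f i else 0 := by
  let ψ : {e : (familyGraph s r f).E //
      (familyGraph s r f).s e = x ∧ (familyGraph s r f).r e = y} ≃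
      Σ i : I, {k : ℕ // (k : ℕ∞) < (if s i = x ∧ r i = y then f i else 0)} :=
    { toFun := fun e => ⟨e.1.1, e.1.2.1, by
        have h : s e.1.1 = x ∧ r e.1.1 = y := e.2
        rw [if_pos h]; exact e.1.2.2⟩
      invFun := fun e =>
        have h : s e.1 = x ∧ r e.1 = y := by
          by_contra h
          have := e.2.2
          simp [h] at this
        ⟨⟨e.1, e.2.1, e.2.2.trans_eq (if_pos h)⟩, h⟩
      left_inv := fun _ => rfl
      right_inv := fun _ => rfl }
  rw [ENat.card_congr ψ, enatCard_sigma]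
  exact Finset.sum_congr rfl fun i _ => card_subtype_lt _

instance {I X : Type} [Countable I] (s r : I → X) (f : I → ℕ∞) :
    Countable (familyGraph s r f).E :=
  inferInstanceAs (Countable (Σ i : I, {k : ℕ // (k : ℕ∞) < f i}))

/-- Countable graphs with the same number of edges between corresponding vertices are
isomorphic. -/
theorem nonempty_iso_of_card_eq {G H : CKGraph} [Countable G.E] [Countable H.E] (φ : G.V ≃ H.V)
    (h : ∀ x y, ENat.card {e // G.s e = x ∧ G.r e = y} =
      ENat.card {e // H.s e = φ x ∧ H.r e = φ y}) : Nonempty (Iso G H) := by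
  have h' : ∀ p : G.V × G.V, Nonempty ({e // (G.s e, G.r e) = p} ≃
      {e // (φ.symm (H.s e), φ.symm (H.r e)) = p}) := by
    intro ⟨x, y⟩
    refine nonempty_equiv_of_card_eq ?_
    simpa only [Prod.mk.injEq, Equiv.symm_apply_eq] using h x y
  let ψ := fun p => (h' p).some
  let η := Equiv.ofFiberEquiv (f := fun e => (G.s e, G.r e))
    (g := fun e => (φ.symm (H.s e), φ.symm (H.r e))) ψ
  have hη : ∀ e, (φ.symm (H.s (η e)), φ.symm (H.r (η e))) = (G.s e, G.r e) := fun e =>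
    Equiv.ofFiberEquiv_map ψ e
  refine ⟨⟨φ, η, fun e => ?_, fun e => ?_⟩⟩
  · rw [← Equiv.symm_apply_eq]; exact (Prod.ext_iff.1 (hη e)).2
  · rw [← Equiv.symm_apply_eq]; exact (Prod.ext_iff.1 (hη e)).1

theorem nonempty_iso_familyGraph {I J X Y : Type} [Fintype I] [Fintype J] [DecidableEq X]
    [DecidableEq Y] (φ : X ≃ Y) (s r : I → X) (f : I → ℕ∞) (s' r' : J → Y) (g : J → ℕ∞)
    (h : ∀ x y, (∑ i, if s i = x ∧ r i = y then f i else 0) =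
      ∑ j, if s' j = φ x ∧ r' j = φ y then g j else 0) :
    Nonempty (Iso (familyGraph s r f) (familyGraph s' r' g)) :=
  nonempty_iso_of_card_eq (G := familyGraph s r f) (H := familyGraph s' r' g) φ fun x y =>
    (card_familyGraph_edges s r f x y).trans
      ((h x y).trans (card_familyGraph_edges s' r' g (φ x) (φ y)).symm)

theorem sum_matGraph {X : Type} [Fintype X] [DecidableEq X] (A : X → X → ℕ∞) (x y : X) :
    (∑ p : X × X, if p.1 = x ∧ p.2 = y then A p.1 p.2 else 0) = A x y := by
  simp [Fintype.sum_prod_type, ite_and]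

theorem matGraph_moveEquiv_familyGraph {I X : Type} [Fintype I] [Fintype X] [DecidableEq X]
    (A : X → X → ℕ∞) (s r : I → X) (f : I → ℕ∞)
    (h : ∀ x y, A x y = ∑ i, if s i = x ∧ r i = y then f i else 0) :
    MoveEquiv (matGraph A) (familyGraph s r f) :=
  .of_iso (inferInstanceAs (Finite X)) <| nonempty_iso_familyGraph (Equiv.refl X) _ _ _ _ _ _
    fun x y => (sum_matGraph A x y).trans (h x y)

theorem matGraph_moveEquiv_reindex {X Y : Type} [Fintype X] [Fintype Y] (φ : X ≃ Y)
    (A : X → X → ℕ∞) (B : Y → Y → ℕ∞) (h : ∀ x y, A x y = B (φ x) (φ y)) :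
    MoveEquiv (matGraph A) (matGraph B) := by
  classical
  refine .of_iso (inferInstanceAs (Finite X)) <| nonempty_iso_familyGraph φ _ _ _ _ _ _
    fun x y => ?_
  rw [sum_matGraph, sum_matGraph, h]

theorem graphOfMatrix_moveEquiv {n : ℕ} (A : Matrix (Fin n) (Fin n) ℕ∞) :
    MoveEquiv (graphOfMatrix A) (matGraph A) :=
  .of_iso (inferInstanceAs (Finite (Fin n)))
    ⟨{ vEquiv := Equiv.refl (Fin n)
       eEquiv :=
         { toFun := fun e => ⟨(e.1, e.2.1), e.2.2⟩
           invFun := fun e => ⟨e.1.1, e.1.2, e.2⟩ }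
       map_r := fun _ => rfl
       map_s := fun _ => rfl }⟩

/-- Out-splitting `v` into two vertices, with rows `R (some v)` and `R none`. -/
theorem matGraph_outSplit {X : Type} [Fintype X] [DecidableEq X] (R : Option X → X → ℕ∞) (v : X)
    (hfin : ∀ y, R none y ≠ ⊤) (hnone : ∃ y, R none y ≠ 0) (hsome : ∃ y, R (some v) y ≠ 0) :
    MoveEquiv (matGraph fun x y => R (some x) y + if x = v then R none y else 0)
      (matGraph fun a b => R a (b.getD v)) := by
  let G := familyGraph (I := Option X × X) (fun p => p.1.getD v) Prod.snd (fun p => R p.1 p.2)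
  refine .trans (matGraph_moveEquiv_familyGraph (I := Option X × X) _ (fun p => p.1.getD v)
    Prod.snd (fun p => R p.1 p.2) ?_) ?_
  · intro x y
    simp [Fintype.sum_prod_type, Fintype.sum_option, ite_and, add_comm, eq_comm]
  obtain ⟨y₀, hy₀⟩ := hnone
  obtain ⟨y₁, hy₁⟩ := hsome
  let P : {e : G.E // G.s e = v} → Fin 2 := fun e => if e.1.1.1 = none then 1 else 0
  let e₀ : {e : G.E // G.s e = v} := ⟨⟨(none, y₀), 0, by simpa [pos_iff_ne_zero] using hy₀⟩, rfl⟩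
  let e₁ : {e : G.E // G.s e = v} :=
    ⟨⟨(some v, y₁), 0, by simpa [pos_iff_ne_zero] using hy₁⟩, rfl⟩
  have hPfin : {x | P x = 1}.Finite := by
    have hfin' : ∀ y, Finite {k : ℕ // (k : ℕ∞) < R none y} := fun y => by
      rw [← ENat.card_lt_top, card_subtype_lt]
      exact lt_top_iff_ne_top.2 (hfin y)
    refine Set.Finite.subset (Set.finite_range
      (fun q : Σ y, {k : ℕ // (k : ℕ∞) < R none y} =>
        (⟨⟨(none, q.1), q.2⟩, rfl⟩ : {e : G.E // G.s e = v}))) ?_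
    rintro ⟨⟨⟨a, y⟩, k⟩, h⟩ hP
    cases a with
    | none => exact ⟨⟨y, k⟩, rfl⟩
    | some x => simp [P] at hP
  refine .moveO (G := G) (inferInstanceAs (Finite X)) v (fun h => h e₀.1 e₀.2) 2 P ?_ ?_ ?_
  · intro i
    fin_cases i
    · exact ⟨e₁, rfl⟩
    · exact ⟨e₀, rfl⟩
  · intro i j hi hj
    fin_cases i <;> fin_cases j
    · rfl
    · exact absurd hPfin hj
    · exact absurd hPfin hi
    · rfl
  · let ν : Option X → {w : X // w ≠ v} ⊕ Fin 2 := fun a =>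
      match a with
      | none => .inr 1
      | some x => if h : x = v then .inr 0 else .inl ⟨x, h⟩
    let ε : (matGraph fun a b => R a (b.getD v)).E →
        {e : G.E // G.r e ≠ v} ⊕ ({e : G.E // G.r e = v} × Fin 2) := fun e =>
      match e with
      | ⟨(a, none), k⟩ => .inr (⟨⟨(a, v), k⟩, rfl⟩, 1)
      | ⟨(a, some x), k⟩ =>
        if h : x = v then .inr (⟨⟨(a, x), k⟩, h⟩, 0) else .inl ⟨⟨(a, x), k⟩, h⟩
    have hν : Function.Bijective ν := by
      constructor
      · rintro (_ | x) (_ | y) h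
        · rfl
        · by_cases hy : y = v <;> simp [ν, hy] at h
        · by_cases hx : x = v <;> simp [ν, hx] at h
        · by_cases hx : x = v <;> by_cases hy : y = v <;> simp [ν, hx, hy] at h <;> simp_all
      · rintro (⟨x, hx⟩ | i)
        · exact ⟨some x, by simp [ν, hx]⟩
        · fin_cases i
          · exact ⟨some v, by simp [ν]⟩
          · exact ⟨none, rfl⟩
    have hν₀ : ∀ x, x = v → ν (some x) = .inr 0 := fun x h => dif_pos h
    have hν₁ : ∀ x (h : x ≠ v), ν (some x) = .inl ⟨x, h⟩ := fun x h => dif_neg h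
    have hbase : ∀ e, Sum.elim (fun e => e.1) (fun p => p.1.1) (ε e) =
        (⟨(e.1.1, e.1.2.getD v), e.2⟩ : G.E) := by
      rintro ⟨⟨a, _ | x⟩, k⟩
      · rfl
      · by_cases hx : x = v
        · simp only [ε, dif_pos hx]; rfl
        · simp only [ε, dif_neg hx]; rfl
    have hr : ∀ e, (G.outSplit v 2 P).r (ε e) = ν e.1.2 := by
      rintro ⟨⟨a, _ | x⟩, k⟩
      · rfl
      · by_cases hx : x = v
        · simp only [ε, ν, dif_pos hx]; rfl
        · simp only [ε, ν, dif_neg hx]; rfl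
    have hε : Function.Bijective ε := by
      constructor
      · rintro ⟨⟨a, b⟩, k⟩ ⟨⟨a', b'⟩, k'⟩ h
        obtain rfl : b = b' := hν.1 ((hr _).symm.trans ((congrArg _ h).trans (hr _)))
        have h' := (hbase _).symm.trans ((congrArg _ h).trans (hbase _))
        cases h'
        rfl
      · rintro (⟨⟨⟨a, x⟩, k⟩, hx⟩ | ⟨⟨⟨⟨a, x⟩, k⟩, hx⟩, i⟩)
        · exact ⟨⟨(a, some x), k⟩, dif_neg hx⟩
        · fin_cases i
          · exact ⟨⟨(a, some x), k⟩, dif_pos hx⟩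
          · obtain rfl : x = v := hx
            exact ⟨⟨(a, none), k⟩, rfl⟩
    refine ⟨⟨Equiv.ofBijective ν hν, Equiv.ofBijective ε hε, hr, fun e => ?_⟩⟩
    have hs : ∀ x, (G.outSplit v 2 P).s x =
        ν (Sum.elim (fun e => e.1) (fun p => p.1.1) x : G.E).1.1 := by
      have key : ∀ (e : G.E) (_ : Decidable (G.s e = v)),
          (if h : G.s e = v then Sum.inr (P ⟨e, h⟩) else Sum.inl ⟨G.s e, h⟩ :
            {w : X // w ≠ v} ⊕ Fin 2) = ν e.1.1 := by
        rintro ⟨⟨_ | x, y⟩, k⟩ _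
        · exact dif_pos rfl
        · by_cases hx : x = v
          · exact (dif_pos hx).trans (hν₀ x hx).symm
          · exact (dif_neg hx).trans (hν₁ x hx).symm
      rintro (e | p)
      · exact key e.1 _
      · exact key p.1.1 _
    exact (hs (ε e)).trans (congrArg (fun e : G.E => ν e.1.1) (hbase e))

/-- In-splitting `v` into two vertices, with columns `L · (some v)` and `L · none`. -/
theorem matGraph_inSplit {X : Type} [Fintype X] [DecidableEq X] (L : X → Option X → ℕ∞) (v : X)
    (hfin : ∀ b, L v b ≠ ⊤) (hv : ∃ b, L v b ≠ 0) (hnone : ∃ x, L x none ≠ 0)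
    (hsome : ∃ x, L x (some v) ≠ 0) :
    MoveEquiv (matGraph fun x y => L x (some y) + if y = v then L x none else 0)
      (matGraph fun a b => L (a.getD v) b) := by
  let G := familyGraph (I := X × Option X) Prod.fst (fun p => p.2.getD v) (fun p => L p.1 p.2)
  refine .trans (matGraph_moveEquiv_familyGraph (I := X × Option X) _ Prod.fst
    (fun p => p.2.getD v) (fun p => L p.1 p.2) ?_) ?_
  · intro x y
    simp [Fintype.sum_prod_type, Fintype.sum_option, ite_and, add_comm, eq_comm]
  obtain ⟨x₀, hx₀⟩ := hnone
  obtain ⟨x₁, hx₁⟩ := hsome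
  obtain ⟨b₀, hb₀⟩ := hv
  let P : {e : G.E // G.r e = v} → Fin 2 := fun e => if e.1.1.2 = none then 1 else 0
  let e₀ : {e : G.E // G.r e = v} := ⟨⟨(x₀, none), 0, by simpa [pos_iff_ne_zero] using hx₀⟩, rfl⟩
  let e₁ : {e : G.E // G.r e = v} :=
    ⟨⟨(x₁, some v), 0, by simpa [pos_iff_ne_zero] using hx₁⟩, rfl⟩
  have hreg : G.Regular v := by
    refine ⟨⟨⟨(v, b₀), 0, by simpa [pos_iff_ne_zero] using hb₀⟩, rfl⟩, ?_⟩
    have hfin' : ∀ b, Finite {k : ℕ // (k : ℕ∞) < L v b} := fun b => by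
      rw [← ENat.card_lt_top, card_subtype_lt]
      exact lt_top_iff_ne_top.2 (hfin b)
    refine Set.Finite.subset (Set.finite_range
      (fun q : Σ b, {k : ℕ // (k : ℕ∞) < L v b} => (⟨(v, q.1), q.2⟩ : G.E))) ?_
    rintro ⟨⟨x, b⟩, k⟩ h
    obtain rfl : x = v := h
    exact ⟨⟨b, k⟩, rfl⟩
  refine .moveI (G := G) (inferInstanceAs (Finite X)) v hreg (fun h => h e₀.1 e₀.2) 2 P ?_ ?_
  · intro i
    fin_cases i
    · exact ⟨e₁, rfl⟩
    · exact ⟨e₀, rfl⟩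
  · let ν : Option X → {w : X // w ≠ v} ⊕ Fin 2 := fun a =>
      match a with
      | none => .inr 1
      | some x => if h : x = v then .inr 0 else .inl ⟨x, h⟩
    let ε : (matGraph fun a b => L (a.getD v) b).E →
        {e : G.E // G.s e ≠ v} ⊕ ({e : G.E // G.s e = v} × Fin 2) := fun e =>
      match e with
      | ⟨(none, b), k⟩ => .inr (⟨⟨(v, b), k⟩, rfl⟩, 1)
      | ⟨(some x, b), k⟩ =>
        if h : x = v then .inr (⟨⟨(x, b), k⟩, h⟩, 0) else .inl ⟨⟨(x, b), k⟩, h⟩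
    have hν : Function.Bijective ν := by
      constructor
      · rintro (_ | x) (_ | y) h
        · rfl
        · by_cases hy : y = v <;> simp [ν, hy] at h
        · by_cases hx : x = v <;> simp [ν, hx] at h
        · by_cases hx : x = v <;> by_cases hy : y = v <;> simp [ν, hx, hy] at h <;> simp_all
      · rintro (⟨x, hx⟩ | i)
        · exact ⟨some x, by simp [ν, hx]⟩
        · fin_cases i
          · exact ⟨some v, by simp [ν]⟩
          · exact ⟨none, rfl⟩
    have hν₀ : ∀ x, x = v → ν (some x) = .inr 0 := fun x h => dif_pos h
    have hν₁ : ∀ x (h : x ≠ v), ν (some x) = .inl ⟨x, h⟩ := fun x h => dif_neg h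
    have hbase : ∀ e, Sum.elim (fun e => e.1) (fun p => p.1.1) (ε e) =
        (⟨(e.1.1.getD v, e.1.2), e.2⟩ : G.E) := by
      rintro ⟨⟨_ | x, b⟩, k⟩
      · rfl
      · by_cases hx : x = v
        · simp only [ε, dif_pos hx]; rfl
        · simp only [ε, dif_neg hx]; rfl
    have hs : ∀ e, (G.inSplit v 2 P).s (ε e) = ν e.1.1 := by
      rintro ⟨⟨_ | x, b⟩, k⟩
      · rfl
      · by_cases hx : x = v
        · simp only [ε, ν, dif_pos hx]; rfl
        · simp only [ε, ν, dif_neg hx]; rfl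
    have hε : Function.Bijective ε := by
      constructor
      · rintro ⟨⟨a, b⟩, k⟩ ⟨⟨a', b'⟩, k'⟩ h
        obtain rfl : a = a' := hν.1 ((hs _).symm.trans ((congrArg _ h).trans (hs _)))
        have h' := (hbase _).symm.trans ((congrArg _ h).trans (hbase _))
        cases h'
        rfl
      · rintro (⟨⟨⟨x, b⟩, k⟩, hx⟩ | ⟨⟨⟨⟨x, b⟩, k⟩, hx⟩, i⟩)
        · exact ⟨⟨(some x, b), k⟩, dif_neg hx⟩
        · fin_cases i
          · exact ⟨⟨(some x, b), k⟩, dif_pos hx⟩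
          · obtain rfl : x = v := hx
            exact ⟨⟨(none, b), k⟩, rfl⟩
    refine ⟨⟨Equiv.ofBijective ν hν, Equiv.ofBijective ε hε, fun e => ?_, hs⟩⟩
    have hr : ∀ x, (G.inSplit v 2 P).r x =
        ν (Sum.elim (fun e => e.1) (fun p => p.1.1) x : G.E).1.2 := by
      have key : ∀ (e : G.E) (_ : Decidable (G.r e = v)),
          (if h : G.r e = v then Sum.inr (P ⟨e, h⟩) else Sum.inl ⟨G.r e, h⟩ :
            {w : X // w ≠ v} ⊕ Fin 2) = ν e.1.2 := by
        rintro ⟨⟨x, _ | y⟩, k⟩ _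
        · exact dif_pos rfl
        · by_cases hy : y = v
          · exact (dif_pos hy).trans (hν₀ y hy).symm
          · exact (dif_neg hy).trans (hν₁ y hy).symm
      rintro (e | p)
      · exact key e.1 _
      · exact key p.1.1 _
    exact (hr (ε e)).trans (congrArg (fun e : G.E => ν e.1.2) (hbase e))

/-- The matrix obtained from `A` by adding an index `none` with column `c`, row `r` and
diagonal entry `0`. -/
def extend {X : Type} (A : X → X → ℕ∞) (c r : X → ℕ∞) : Option X → Option X → ℕ∞
  | some x, some y => A x y
  | some x, none => c x
  | none, some y => r y
  | none, none => 0

/-- Reducing a vertex which emits one edge, to `w`, and receives only from `v`. -/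
theorem extend_moveEquiv_of_single {X : Type} [Fintype X] [DecidableEq X] (A : X → X → ℕ∞)
    (a : ℕ∞) (v w : X) :
    MoveEquiv (matGraph (extend A (fun x => if x = v then a else 0)
        (fun y => if y = w then 1 else 0)))
      (matGraph fun x y => A x y + if x = v ∧ y = w then a else 0) := by
  let G := familyGraph (I := (X × X) ⊕ (Unit ⊕ Unit)) (X := Option X)
    (Sum.elim (fun p => some p.1) (Sum.elim (fun _ => some v) (fun _ => none)))
    (Sum.elim (fun p => some p.2) (Sum.elim (fun _ => none) (fun _ => some w)))
    (Sum.elim (fun p => A p.1 p.2) (Sum.elim (fun _ => a) (fun _ => 1)))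
  let H := familyGraph (I := (X × X) ⊕ Unit) (X := X)
    (Sum.elim Prod.fst (fun _ => v)) (Sum.elim Prod.snd (fun _ => w))
    (Sum.elim (fun p => A p.1 p.2) (fun _ => a))
  refine .trans (K := matGraph fun x y => A x y + if x = v ∧ y = w then a else 0)
    (matGraph_moveEquiv_familyGraph (I := (X × X) ⊕ (Unit ⊕ Unit)) _
    (Sum.elim (fun p => some p.1) (Sum.elim (fun _ => some v) (fun _ => none)))
    (Sum.elim (fun p => some p.2) (Sum.elim (fun _ => none) (fun _ => some w)))
    (Sum.elim (fun p => A p.1 p.2) (Sum.elim (fun _ => a) (fun _ => 1))) ?_)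
    (.trans (H := H) ?_ (matGraph_moveEquiv_familyGraph (I := (X × X) ⊕ Unit) _
      (Sum.elim Prod.fst (fun _ => v)) (Sum.elim Prod.snd (fun _ => w))
      (Sum.elim (fun p => A p.1 p.2) (fun _ => a)) ?_).symm)
  · rintro (_ | x) (_ | y) <;>
      simp [extend, Fintype.sum_prod_type, ite_and, eq_comm]
  · let f : G.E := ⟨.inr (.inr ()), 0, by simp⟩
    refine .moveR (G := G) (inferInstanceAs (Finite (Option X))) none f rfl
      (by intro h; cases h) ?_ (some v) ?_ ?_
    · rintro ⟨p | _ | _, k, hk⟩ h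
      · cases h
      · cases h
      · obtain rfl : k = 0 := by simpa using hk
        rfl
    · rintro ⟨p | _ | _, k⟩ h
      · cases h
      · rfl
      · cases h
    · let ν : X → {a : Option X // a ≠ none} := fun x => ⟨some x, Option.some_ne_none x⟩
      let ε : H.E → {e : G.E // G.r e ≠ none ∧ e ≠ f} ⊕ {e : G.E // G.r e = none} := fun e =>
        match e with
        | ⟨.inl p, k⟩ => .inl ⟨⟨.inl p, k⟩, Option.some_ne_none _,
            fun h => nomatch congrArg Sigma.fst h⟩
        | ⟨.inr _, k⟩ => .inr ⟨⟨.inr (.inl ()), k⟩, rfl⟩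
      have hν : Function.Bijective ν := by
        constructor
        · intro x y h
          exact Option.some_injective _ (congrArg Subtype.val h)
        · rintro ⟨_ | x, h⟩
          · exact absurd rfl h
          · exact ⟨x, rfl⟩
      have hε : Function.Bijective ε := by
        constructor
        · rintro ⟨p | _, k⟩ ⟨q | _, l⟩ h
          · cases h; rfl
          · cases h
          · cases h
          · cases h; rfl
        · rintro (⟨⟨p | _ | _, k, hk⟩, h₁, h₂⟩ | ⟨⟨p | _ | _, k⟩, h⟩)
          · exact ⟨⟨.inl p, k, hk⟩, rfl⟩
          · exact absurd rfl h₁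
          · obtain rfl : k = 0 := by simpa using hk
            exact absurd rfl h₂
          · cases h
          · exact ⟨⟨.inr (), k⟩, rfl⟩
          · cases h
      refine ⟨⟨Equiv.ofBijective ν hν, Equiv.ofBijective ε hε, ?_, ?_⟩⟩
      · rintro ⟨p | _, k⟩ <;> rfl
      · rintro ⟨p | _, k⟩ <;> rfl
  · intro x y
    simp only [Fintype.sum_sum_type, Sum.elim_inl, Sum.elim_inr]
    refine congrArg₂ _ (sum_matGraph A x y).symm ?_
    simp only [Finset.univ_unique, Finset.sum_singleton, eq_comm]
    congr

theorem matGraph_congr {X : Type} [Fintype X] {A B : X → X → ℕ∞} (h : ∀ x y, A x y = B x y) :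
    MoveEquiv (matGraph A) (matGraph B) :=
  matGraph_moveEquiv_reindex (Equiv.refl X) A B h

/-- Collapsing a vertex which emits a single edge, to `j`. -/
theorem extend_moveEquiv_of_single_row {X : Type} [Fintype X] [DecidableEq X] (j : X)
    (S : Finset X) (A : X → X → ℕ∞) (c : X → ℕ∞) (hc : ∀ x ∉ S, c x = 0) :
    MoveEquiv (matGraph (extend A c (fun y => if y = j then 1 else 0)))
      (matGraph fun x y => A x y + if y = j then c x else 0) := by
  have single : ∀ (A : X → X → ℕ∞) (c : X → ℕ∞) (a : X), (∀ x, x ≠ a → c x = 0) →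
      MoveEquiv (matGraph (extend A c (fun y => if y = j then 1 else 0)))
        (matGraph fun x y => A x y + if y = j then c x else 0) := fun A c a hca => by
    have hc' : c = fun x => if x = a then c a else 0 := by
      ext1 x
      split_ifs with h
      · rw [h]
      · exact hca x h
    refine .trans ?_ ((extend_moveEquiv_of_single A (c a) a j).trans (matGraph_congr fun x y => ?_))
    · rw [← hc']
      exact matGraph_congr fun _ _ => rfl
    · by_cases hx : x = a <;> simp [hx]
      rw [hca x hx]
      simp
  induction S using Finset.induction_on generalizing A c with
  | empty => exact single A c j fun x _ => hc x (by simp)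
  | insert a S ha ih =>
    let c₁ : X → ℕ∞ := fun x => if x = a then 0 else c x
    let c₂ : X → ℕ∞ := fun x => if x = a then c a else 0
    have hc₁ : ∀ x ∉ S, c₁ x = 0 := fun x hx => by
      by_cases h : x = a
      · simp [c₁, h]
      · simpa [c₁, h] using hc x (by simp [h, hx])
    have hc₁₂ : ∀ x, c₁ x + c₂ x = c x := fun x => by
      by_cases h : x = a <;> simp [c₁, c₂, h]
    by_cases h₂ : c a = 0
    · exact ih A c fun x hx => by
        by_cases h : x = a
        · exact h ▸ h₂
        · exact hc x (by simp [h, hx])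
    by_cases h₁ : ∀ x, c₁ x = 0
    · exact single A c a fun x hx => by simpa [c₁, hx] using h₁ x
    push Not at h₁
    obtain ⟨x₁, hx₁⟩ := h₁
    let δ : X → ℕ∞ := fun y => if y = j then 1 else 0
    let L : Option X → Option (Option X) → ℕ∞ := fun p q =>
      match q with
      | some (some y) => extend A c δ p (some y)
      | some none => p.elim 0 c₁
      | none => p.elim 0 c₂
    have key := matGraph_inSplit L none
      (by
        rintro (_ | _ | y) <;> simp only [L, extend, δ, Option.elim_none] <;>
          (try split_ifs) <;> simp)
      ⟨some (some j), by simp [L, extend, δ]⟩ ⟨some a, by simpa [L, c₂] using h₂⟩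
      ⟨some x₁, by simpa [L] using hx₁⟩
    refine .trans (matGraph_congr ?_) (key.trans (.trans (matGraph_congr ?_)
      ((extend_moveEquiv_of_single (extend A c₁ δ) (c a) (some a) (some j)).trans
        (.trans (matGraph_congr ?_) ((ih (fun x y => A x y + if y = j then c₂ x else 0) c₁
          hc₁).trans (matGraph_congr ?_))))))
    · rintro (_ | x) (_ | y) <;> simp [L, extend, δ, hc₁₂]
    · rintro (_ | _ | x) (_ | _ | y) <;> simp [L, extend, δ, c₂]
    · rintro (_ | x) (_ | y) <;> simp [extend, δ, c₂]
      by_cases hx : x = a <;> simp [hx]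
    · intro x y
      by_cases hy : y = j <;> simp [hy, ← hc₁₂ x, add_left_comm, add_comm]

/-- Collapsing a vertex without loops, with finitely many outgoing edges, at least one. -/
theorem extend_moveEquiv {X : Type} [Fintype X] [DecidableEq X] (s : Multiset X) (hs : s ≠ 0)
    (A : X → X → ℕ∞) (c : X → ℕ∞) :
    MoveEquiv (matGraph (extend A c (fun y => s.count y)))
      (matGraph fun x y => A x y + c x * s.count y) := by
  induction s using Multiset.induction_on generalizing A with
  | empty => exact absurd rfl hs
  | cons j s ih =>
    by_cases hs : s = 0
    · subst hs
      refine .trans (matGraph_congr ?_) ((extend_moveEquiv_of_single_row j Finset.univ A c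
        (by simp)).trans (matGraph_congr ?_))
      · rintro (_ | x) (_ | y) <;> simp [extend, Multiset.count_singleton]
      · intro x y
        simp [Multiset.count_singleton]
    let R : Option (Option X) → Option X → ℕ∞ := fun p q =>
      match p with
      | some (some x) => extend A c (fun _ => 0) (some x) q
      | some none => q.elim 0 fun y => s.count y
      | none => q.elim 0 fun y => if y = j then 1 else 0
    obtain ⟨i, hi⟩ := Multiset.exists_mem_of_ne_zero hs
    have key := matGraph_outSplit R none
      (by
        rintro (_ | y) <;> simp only [R, Option.elim_none, Option.elim_some] <;>
          (try split_ifs) <;> simp) ⟨some j, by simp [R]⟩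
      ⟨some i, by simpa [R] using hi⟩
    refine .trans (matGraph_congr ?_) (key.trans (.trans (matGraph_congr ?_)
      ((extend_moveEquiv_of_single_row (some j) Finset.univ (extend A c (fun y => s.count y))
        (fun x => x.elim 0 c) (by simp)).trans
        (.trans (matGraph_congr ?_) ((ih hs (fun x y => A x y + if y = j then c x else 0)).trans
          (matGraph_congr ?_))))))
    · rintro (_ | x) (_ | y) <;> simp [R, extend, Multiset.count_cons]
    · rintro (_ | _ | x) (_ | _ | y) <;> simp [R, extend]
    · rintro (_ | x) (_ | y) <;> simp [extend]
    · intro x y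
      by_cases hy : y = j
      · simp only [hy, if_true, Multiset.count_cons_self, Nat.cast_add, Nat.cast_one, mul_add,
          mul_one]
        ac_rfl
      · simp [hy]

/-- Column addition: the finite part `r` of the row of `v` may be pushed onto the vertices which
emit to `v`. -/
theorem matGraph_colAdd {X : Type} [Fintype X] [DecidableEq X] (A : X → X → ℕ∞) (v : X)
    (r : X → ℕ) (hrv : r v = 0) (hr : ∃ y, r y ≠ 0) (hA : ∃ y, A v y ≠ 0) :
    MoveEquiv (matGraph fun x y => A x y + if x = v then (r y : ℕ∞) else 0)
      (matGraph fun x y => A x y + A x v * r y) := by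
  let s : Multiset X := ∑ y, Multiset.replicate (r y) y
  have hs : ∀ y, s.count y = r y := fun y => by
    simp [s, Multiset.count_sum', Multiset.count_replicate]
  let R : Option X → X → ℕ∞ := fun p y => p.elim (r y) fun x => A x y
  obtain ⟨i, hi⟩ := hr
  have key := matGraph_outSplit R v (by simp [R]) ⟨i, by simpa [R] using hi⟩ (by simpa [R] using hA)
  refine key.trans (.trans (matGraph_congr ?_) ((extend_moveEquiv s ?_ A fun x => A x v).trans
    (matGraph_congr ?_)))
  · rintro (_ | x) (_ | y) <;> simp [R, extend, hs, hrv]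
  · intro h
    exact hi (by rw [← hs, h]; simp)
  · intro x y
    rw [hs]

/-- The matrix obtained from `C` by adding the identity in the rows satisfying `P` and replacing
the entries of the other rows by `∞`. -/
def singularize {X : Type} [DecidableEq X] (P : X → Bool) (C : X → X → ℕ) :
    X → X → ℕ∞ :=
  fun x y => if P x then (if x = y then 1 else 0) + (C x y : ℕ∞) else ⊤

/-- The enlargement of `C` by two indices, with a column of ones at `z`. -/
def enlarge {X : Type} [DecidableEq X] (C : X → X → ℕ) (z s : X) :
    Option (Option X) → Option (Option X) → ℕ
  | some (some x), some (some y) => if y = z then 1 else C x y + 1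
  | some (some x), some none => C x z + 2 * C x s + 1
  | some (some x), none => C x s + 1
  | some none, _ => 1
  | none, b => if b = some (some s) then 2 else 1

theorem singularize_moveEquiv_enlarge {X : Type} [Fintype X] [DecidableEq X] (P : X → Bool)
    (C : X → X → ℕ) (hC : ∀ x, P x → ∀ y, C x y ≠ 0) (z s : X) (hz : P z)
    (hs : ¬ P s) :
    MoveEquiv (matGraph (singularize P C))
      (matGraph (singularize (fun a : Option (Option X) => a.elim true fun b => b.elim true P)
        (enlarge C z s))) := by
  have hzs : s ≠ z := fun h => hs (h ▸ hz)
  have hne : ∀ x, P x → x ≠ s := fun x hx h => hs (h ▸ hx)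
  let A : X → X → ℕ∞ := singularize P C
  let A₀ : X → X → ℕ∞ := fun x y =>
    if P x then (if y = z then 1 + if x = z then 1 else 0 else A x y) else ⊤
  let c : X → ℕ∞ := fun x => if P x then ((C x z + 2 * C x s - 1 : ℕ) : ℕ∞) else ⊤
  let A₁ : X → X → ℕ∞ := fun x y => if x = z ∧ y ≠ z then ((C x y - 1 : ℕ) : ℕ∞) else A₀ x y
  let c₁ : X → ℕ∞ := fun x => if x = z then ((C x z + 2 * C x s - 3 : ℕ) : ℕ∞) else c x
  let r : Option X → ℕ := fun a => a.elim 2 fun y => if y = z then 0 else 1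
  let R : Option (Option X) → Option X → ℕ∞ := fun a b =>
    match a with
    | some (some x) => if P x then enlarge C z s (some (some x)) (some b) +
        (if some x = b then 1 else 0) else ⊤
    | some none => if b = none then 2 else 1
    | none => if b = some s then 2 else 1
  have h₁ := matGraph_colAdd A s (fun y => if y = z then 2 else 0) (by simp [hzs])
    ⟨z, by simp⟩ ⟨z, by simp [A, singularize, hs]⟩
  have h₂ := extend_moveEquiv_of_single_row z Finset.univ A₀ c (by simp)
  have h₃ := matGraph_colAdd (extend A₁ c₁ fun y => if y = z then 1 else 0) (some z) r
    (by simp [r]) ⟨none, by simp [r]⟩ ⟨some z, by simp [extend, A₁, A₀, hz]⟩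
  have h₄ := matGraph_outSplit R (some s)
    (by rintro (_ | y) <;> simp only [R] <;> split_ifs <;> simp) ⟨none, by simp [R]⟩
    ⟨some s, by simp [R, hs]⟩
  have h12 : 1 + 1 = (2 : ℕ∞) := by norm_num
  refine .trans (matGraph_congr ?_) (h₁.trans (.trans (matGraph_congr ?_) (h₂.symm.trans
    (.trans (matGraph_congr ?_) (h₃.trans (.trans (matGraph_congr ?_)
      (h₄.trans (matGraph_congr ?_))))))))
  · intro x y
    by_cases hx : x = s <;> simp [A, singularize, hx, hs]
  · intro x y
    by_cases hx : P x
    · by_cases hy : y = z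
      · have := hC x hx z
        by_cases hxz : x = z
        · subst hxz
          simp [A, A₀, c, singularize, hx, hy, hne]
          norm_cast
          omega
        · simp [A, A₀, c, singularize, hx, hy, hxz, hne]
          norm_cast
          omega
      · simp [A, A₀, c, singularize, hx, hy]
    · by_cases hy : y = z <;> simp [A, A₀, c, singularize, hx, hy]
  · have := hC z hz z
    have := hC z hz s
    rintro (_ | x) (_ | y)
    · simp [extend]
    · simp [extend]
    · by_cases hx : x = z
      · simp [extend, r, hx, c₁, c, hz]
        norm_cast
        omega
      · simp [extend, hx, c₁]
    · have := hC z hz y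
      by_cases hx : x = z
      · by_cases hy : y = z
        · simp [extend, r, hx, hy, A₁, A₀, hz]
        · simp [extend, r, hx, hy, A₁, A₀, A, singularize, hz, Ne.symm hy]
          norm_cast
          omega
      · simp [extend, hx, A₁]
  · rintro (_ | x) (_ | y)
    · simp [R, r, extend]
    · by_cases hy : y = z <;> simp [R, r, extend, hy]
    · by_cases hx : P x
      · have := hC x hx z
        have := hC x hx s
        by_cases hxz : x = z
        · subst hxz
          simp [R, r, extend, hx, A₁, A₀, c₁, enlarge, hne]
          norm_cast
          omega
        · simp [R, r, extend, hx, hxz, A₁, A₀, c₁, c, enlarge, hne]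
          norm_cast
          omega
      · have hxz : x ≠ z := fun h => hx (h ▸ hz)
        simp [R, r, extend, hx, hxz, A₁, A₀, c₁, c]
    · by_cases hx : P x
      · have := hC x hx y
        by_cases hxz : x = z
        · subst hxz
          by_cases hy : y = x
          · simp [R, r, extend, hx, hy, A₁, A₀, enlarge, hne]
          · simp [R, r, extend, hx, hy, A₁, A₀, enlarge, hne, Ne.symm hy]
            norm_cast
            omega
        · by_cases hy : y = z
          · simp [R, r, extend, hx, hxz, hy, A₁, A₀, enlarge, hne]
          · simp [R, r, extend, hx, hxz, hy, A₁, A₀, A, singularize, enlarge, hne]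
            ac_rfl
      · have hxz : x ≠ z := fun h => hx (h ▸ hz)
        simp [R, r, extend, hx, hxz, A₁, A₀]
  · rintro (_ | _ | x) (_ | _ | y)
    · simp [R, singularize, enlarge, h12]
    · simp [R, singularize, enlarge]
    · simp [R, singularize, enlarge]
    · simp [R, singularize, enlarge]
    · simp [R, singularize, enlarge, h12]
    · simp [R, singularize, enlarge]
    · by_cases hx : P x <;> simp [R, singularize, enlarge, hx, hne, hzs]
    · by_cases hx : P x <;> simp [R, singularize, enlarge, hx]
    · by_cases hx : P x <;> simp [R, singularize, enlarge, hx, add_comm]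

end CKGraph

/-- obtaining a first column of ones and a degenerate regular corner. -/
theorem stmt13 {n m : ℕ} (hmn : m < n) (C : Matrix (Fin n) (Fin n) ℕ)
    (hpos : ∀ i : Fin n, i.1 < m → ∀ j, C i j ≠ 0)
    (hzero : ∀ i : Fin n, m ≤ i.1 → ∀ j, C i j = 0)
    (hone : ∃ i j, C i j = 1) :
    ∃ D : Matrix (Fin (n + 2)) (Fin (n + 2)) ℕ,
      (∀ i : Fin (n + 2), m + 2 ≤ i.1 → ∀ j, D i j = 0) ∧
      (∀ i : Fin (n + 2), i.1 < m + 2 → ∀ j, 0 < D i j) ∧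
      (∀ i : Fin (n + 2), i.1 < m + 2 → D i ⟨0, by omega⟩ = 1) ∧
      Matrix.det (Matrix.of fun i j : Fin (m + 2) =>
        (D ⟨i.1, by have := i.2; omega⟩ ⟨j.1, by have := j.2; omega⟩ : ℤ)) = 0 ∧
      MatMoveEquiv (Jmat n m + C.map ((↑) : ℕ → ℕ∞))
        (Jmat (n + 2) (m + 2) + D.map ((↑) : ℕ → ℕ∞)) := by
  classical
  obtain ⟨i₀, j₀, h₀⟩ := hone
  have hi₀ : i₀.1 < m := by
    by_contra h
    simp [hzero i₀ (not_lt.1 h) j₀] at h₀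
  have hm : 0 < m := (Nat.zero_le _).trans_lt hi₀
  let z : Fin n := ⟨0, hm.trans hmn⟩
  let s : Fin n := ⟨m, hmn⟩
  let f : Option (Option (Fin n)) → Fin (n + 2) := fun a =>
    match a with
    | some (some x) => if x.1 < m then ⟨x.1, by omega⟩ else ⟨x.1 + 2, by omega⟩
    | some none => ⟨m, by omega⟩
    | none => ⟨m + 1, by omega⟩
  have hf : Function.Injective f := by
    rintro (_ | _ | x) (_ | _ | y) h <;> first
      | rfl
      | simp only [f] at h
        (try split_ifs at h) <;> simp only [Fin.mk.injEq] at h <;> first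
          | omega
          | exact congrArg _ (congrArg _ (Fin.ext (by omega)))
  let φ : Option (Option (Fin n)) ≃ Fin (n + 2) :=
    Equiv.ofBijective f ((Fintype.bijective_iff_injective_and_card f).2 ⟨hf, by simp⟩)
  let E := CKGraph.enlarge C z s
  let D : Matrix (Fin (n + 2)) (Fin (n + 2)) ℕ :=
    Matrix.of fun i j => if i.1 < m + 2 then E (φ.symm i) (φ.symm j) else 0
  have hD : ∀ i : Fin (n + 2), i.1 < m + 2 → ∀ j, D i j = E (φ.symm i) (φ.symm j) :=
    fun i hi j => if_pos hi
  have hreg : ∀ a : Option (Option (Fin n)), (φ a).1 < m + 2 ↔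
      (a.elim true fun b => b.elim true fun x => decide (x.1 < m)) = true := by
    rintro (_ | _ | x)
    · simp [φ, f]
    · simp [φ, f]
    · by_cases hx : x.1 < m
      · simp [φ, f, hx]; omega
      · simp [φ, f, hx]
  have hφz : φ.symm ⟨0, by omega⟩ = some (some z) := by
    rw [Equiv.symm_apply_eq]
    simp [φ, f, z, hm]
  have hφm : φ.symm ⟨m, by omega⟩ = some none := by
    rw [Equiv.symm_apply_eq]
    rfl
  have hφm' : φ.symm ⟨m + 1, by omega⟩ = none := by
    rw [Equiv.symm_apply_eq]
    rfl
  refine ⟨D, fun i hi j => if_neg hi.not_gt, fun i hi j => ?_, fun i hi => ?_, ?_, ?_⟩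
  · rw [hD i hi]
    generalize φ.symm i = a
    generalize φ.symm j = b
    rcases a with _ | _ | x <;> rcases b with _ | _ | y <;>
      simp only [E, CKGraph.enlarge] <;> (try split_ifs) <;> omega
  · rw [hD i hi, hφz]
    generalize φ.symm i = a
    rcases a with _ | _ | x <;> simp [E, CKGraph.enlarge, z, s, hm.ne]
  · refine Matrix.det_zero_of_row_eq (i := ⟨m, by omega⟩) (j := ⟨m + 1, by omega⟩) (by simp) ?_
    ext j
    have hj : φ.symm ⟨j.1, by omega⟩ ≠ some (some s) := by
      intro h
      have := (hreg (some (some s))).1 (by rw [← h, Equiv.apply_symm_apply]; exact j.2)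
      simp [s] at this
    simp [hD, hφm, hφm', E, CKGraph.enlarge, hj]
  · refine (CKGraph.graphOfMatrix_moveEquiv _).trans (.trans (CKGraph.matGraph_congr ?_)
      ((CKGraph.singularize_moveEquiv_enlarge (fun x : Fin n => decide (x.1 < m)) C
        (fun x hx y => hpos x (by simpa using hx) y) z s (by simpa [z]) (by simp [s])).trans
        (.trans (CKGraph.matGraph_moveEquiv_reindex φ _ _ ?_)
          (CKGraph.graphOfMatrix_moveEquiv _).symm)))
    · intro x y
      by_cases hx : x.1 < m <;> simp [CKGraph.singularize, Jmat, hx]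
    · intro a b
      by_cases ha : (φ a).1 < m + 2
      · simp [CKGraph.singularize, Jmat, (hreg a).1 ha, ha, D, E]
      · simp [CKGraph.singularize, Jmat, mt (hreg a).2 ha, ha]
end
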